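/- arXiv:2212.13801 — 4 statements merged into one kernel-verified Lean document; each statement's English description precedes it below -/
import Mathlib

section
/- There exist ε < 1/2 and an MA-PostPFA M with certificate alphabet {a,b} and input alphabet {a} such that: a(c,x)+r(c,x) > 0 for all certificates and inputs; for every i ≥ 0, on input a^(i²) the certificate (a^i b)^i (which has length i² + i ≤ 2·i² + 1) gives acceptance probability at least 1−ε; and for every n that is not a perfect square and every certificate c ∈ {a,b}*, the rejection probability is at least 1−ε. Hence M verifies USQUARE = { a^(i²) : i ≥ 0 } with bounded error using linear-size binary certificates. -/
open Matrix

/-- A column-stochastic real matrix: nonnegative entries, every column sums to 1. -/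
def ColStochastic {m : ℕ} (A : Matrix (Fin m) (Fin m) ℝ) : Prop :=
  (∀ i j, 0 ≤ A i j) ∧ ∀ j, ∑ i, A i j = 1

/-- The first standard basis column vector `e₁`. -/
def e1 (m : ℕ) : Fin m → ℝ := fun j => if j.val = 0 then 1 else 0

/-- An MA-PostPFA whose certificate and input symbols range over the type `Sym`:
column-stochastic matrices for the markers `◐, ◑, ¢, $` and for each symbol, together
with disjoint sets of postselecting accepting and rejecting states. -/
structure MAPostPFA (Sym : Type) where
  m : ℕ
  Aopen : Matrix (Fin m) (Fin m) ℝ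
  Aclose : Matrix (Fin m) (Fin m) ℝ
  Acent : Matrix (Fin m) (Fin m) ℝ
  Adollar : Matrix (Fin m) (Fin m) ℝ
  Asym : Sym → Matrix (Fin m) (Fin m) ℝ
  hopen : ColStochastic Aopen
  hclose : ColStochastic Aclose
  hcent : ColStochastic Acent
  hdollar : ColStochastic Adollar
  hsym : ∀ s, ColStochastic (Asym s)
  Facc : Finset (Fin m)
  Frej : Finset (Fin m)
  disj : Disjoint Facc Frej

namespace MAPostPFA

variable {Sym : Type}

/-- The final state vector
`v = A_$ · A_{x_l} ⋯ A_{x_1} · A_¢ · A_◑ · A_{c_k} ⋯ A_{c_1} · A_◐ · e₁`. -/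
def finalVec (M : MAPostPFA Sym) (c x : List Sym) : Fin M.m → ℝ :=
  M.Adollar.mulVec <|
    x.foldl (fun v s => (M.Asym s).mulVec v) <|
      M.Acent.mulVec <| M.Aclose.mulVec <|
        c.foldl (fun v s => (M.Asym s).mulVec v) (M.Aopen.mulVec (e1 M.m))

/-- `a(c,x)`: total final weight on the postselecting accepting states. -/
noncomputable def aPr (M : MAPostPFA Sym) (c x : List Sym) : ℝ :=
  ∑ j ∈ M.Facc, M.finalVec c x j

/-- `r(c,x)`: total final weight on the postselecting rejecting states. -/
noncomputable def rPr (M : MAPostPFA Sym) (c x : List Sym) : ℝ :=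
  ∑ j ∈ M.Frej, M.finalVec c x j

/-- Acceptance probability `a/(a+r)` after postselection. -/
noncomputable def accProb (M : MAPostPFA Sym) (c x : List Sym) : ℝ :=
  M.aPr c x / (M.aPr c x + M.rPr c x)

/-- Rejection probability `r/(a+r)` after postselection. -/
noncomputable def rejProb (M : MAPostPFA Sym) (c x : List Sym) : ℝ :=
  M.rPr c x / (M.aPr c x + M.rPr c x)

end MAPostPFA

namespace MAPostPFA

section Realization

variable {Sym S : Type} [Fintype S]

/-- The vector obtained from `v` by applying the matrices of the letters of a word. -/
def run (W : Sym → Matrix S S ℝ) (v : S → ℝ) (c : List Sym) : S → ℝ :=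
  c.foldl (fun v s => (W s).mulVec v) v

/-- Completion of `l • A` to a stochastic matrix by a sink with index `0`. -/
noncomputable def withSink (l : ℝ) (A : Matrix S S ℝ) :
    Matrix (Fin (Fintype.card S + 1)) (Fin (Fintype.card S + 1)) ℝ :=
  Matrix.of <| Fin.cons (Fin.cons 1 fun j => 1 - l * ∑ i, A i ((Fintype.equivFin S).symm j))
    fun i => Fin.cons 0 fun j =>
      l * A ((Fintype.equivFin S).symm i) ((Fintype.equivFin S).symm j)

/-- A stochastic matrix whose columns all equal `l • u` completed by a sink with index `0`. -/
noncomputable def initSink (l : ℝ) (u : S → ℝ) :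
    Matrix (Fin (Fintype.card S + 1)) (Fin (Fintype.card S + 1)) ℝ :=
  Matrix.of <| Fin.cons (fun _ => 1 - l * ∑ i, u i)
    fun i _ => l * u ((Fintype.equivFin S).symm i)

lemma colStochastic_withSink {l : ℝ} (hl : 0 ≤ l) {A : Matrix S S ℝ} (hA : ∀ i j, 0 ≤ A i j)
    (hs : ∀ j, l * ∑ i, A i j ≤ 1) : ColStochastic (withSink l A) := by
  constructor
  · intro i j
    refine Fin.cases ?_ (fun i => ?_) i <;> refine Fin.cases ?_ (fun j => ?_) j
    · simp [withSink]
    · simpa [withSink] using hs _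
    · simp [withSink]
    · simpa [withSink] using mul_nonneg hl (hA _ _)
  · intro j
    refine Fin.cases ?_ (fun j => ?_) j
    · simp [withSink, Fin.sum_univ_succ]
    · simp only [withSink, Fin.sum_univ_succ, Matrix.of_apply, Fin.cons_zero, Fin.cons_succ]
      rw [(Fintype.equivFin S).symm.sum_comp
        fun i => l * A i ((Fintype.equivFin S).symm j), Finset.mul_sum]
      ring

lemma colStochastic_initSink {l : ℝ} (hl : 0 ≤ l) {u : S → ℝ} (hu : ∀ i, 0 ≤ u i)
    (hs : l * ∑ i, u i ≤ 1) : ColStochastic (initSink l u) := by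
  constructor
  · intro i j
    refine Fin.cases ?_ (fun i => ?_) i
    · simpa [initSink] using hs
    · simpa [initSink] using mul_nonneg hl (hu _)
  · intro j
    simp only [initSink, Fin.sum_univ_succ, Matrix.of_apply, Fin.cons_zero, Fin.cons_succ]
    rw [(Fintype.equivFin S).symm.sum_comp fun i => l * u i, Finset.mul_sum]
    ring

lemma colStochastic_one (m : ℕ) : ColStochastic (1 : Matrix (Fin m) (Fin m) ℝ) := by
  refine ⟨fun i j => ?_, fun j => by simp [Matrix.one_apply]⟩
  rw [Matrix.one_apply]
  split_ifs <;> norm_num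

lemma initSink_mulVec (l : ℝ) (u : S → ℝ) (s : S) :
    (initSink l u).mulVec (e1 _) (Fintype.equivFin S s).succ = l * u s := by
  simp [initSink, Matrix.mulVec, dotProduct, e1]

lemma withSink_mulVec {l k : ℝ} {A : Matrix S S ℝ} {v : Fin (Fintype.card S + 1) → ℝ} {u : S → ℝ}
    (h : ∀ s, v (Fintype.equivFin S s).succ = k * u s) (s : S) :
    (withSink l A).mulVec v (Fintype.equivFin S s).succ = k * l * A.mulVec u s := by
  simp only [withSink, Matrix.mulVec, dotProduct, Fin.sum_univ_succ, Matrix.of_apply,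
    Fin.cons_zero, Fin.cons_succ, Equiv.symm_apply_apply, zero_mul, zero_add]
  rw [← (Fintype.equivFin S).sum_comp, Finset.mul_sum]
  refine Finset.sum_congr rfl fun i _ => ?_
  rw [h, Equiv.symm_apply_apply]
  ring

lemma foldl_withSink {l : ℝ} (W : Sym → Matrix S S ℝ) (c : List Sym) {k : ℝ}
    {v : Fin (Fintype.card S + 1) → ℝ} {u : S → ℝ}
    (h : ∀ s, v (Fintype.equivFin S s).succ = k * u s) (s : S) :
    c.foldl (fun v s => (withSink l (W s)).mulVec v) v (Fintype.equivFin S s).succ =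
      k * l ^ c.length * run W u c s := by
  induction c generalizing k v u with
  | nil => simpa [run] using h s
  | cons a c ih =>
    rw [List.foldl_cons, ih (withSink_mulVec h), List.length_cons, pow_succ']
    simp only [run, List.foldl_cons]
    ring

/-- Nonnegative weighted automata are realized by postselecting automata up to a positive factor
depending only on the lengths of the certificate and the input. -/
theorem exists_realization [Fintype Sym] (u : S → ℝ) (W : Sym → Matrix S S ℝ) (D : Matrix S S ℝ)
    (acc rej : Finset S) (hd : Disjoint acc rej) (hu : ∀ i, 0 ≤ u i)
    (hW : ∀ s i j, 0 ≤ W s i j) (hD : ∀ i j, 0 ≤ D i j) :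
    ∃ (M : MAPostPFA Sym) (κ : List Sym → List Sym → ℝ), (∀ c x, 0 < κ c x) ∧
      (∀ c x, M.aPr c x = κ c x * ∑ j ∈ acc, run W (D.mulVec (run W u c)) x j) ∧
      (∀ c x, M.rPr c x = κ c x * ∑ j ∈ rej, run W (D.mulVec (run W u c)) x j) := by
  set T : ℝ := 1 + ((∑ i, u i) + (∑ j, ∑ i, D i j) + ∑ s, ∑ j, ∑ i, W s i j) with hT
  have hu0 : 0 ≤ ∑ i, u i := Finset.sum_nonneg fun i _ => hu i
  have hDc : ∀ j, 0 ≤ ∑ i, D i j := fun j => Finset.sum_nonneg fun i _ => hD i j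
  have hD0 : 0 ≤ ∑ j, ∑ i, D i j := Finset.sum_nonneg fun j _ => hDc j
  have hWc : ∀ s j, 0 ≤ ∑ i, W s i j := fun s j => Finset.sum_nonneg fun i _ => hW s i j
  have hWs : ∀ s, 0 ≤ ∑ j, ∑ i, W s i j := fun s => Finset.sum_nonneg fun j _ => hWc s j
  have hW0 : 0 ≤ ∑ s, ∑ j, ∑ i, W s i j := Finset.sum_nonneg fun s _ => hWs s
  have hTpos : 0 < T := by positivity
  have hscale : ∀ r : ℝ, r ≤ T → T⁻¹ * r ≤ 1 := fun r hr => by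
    rw [inv_mul_le_iff₀ hTpos]; linarith
  have hl : 0 < T⁻¹ := inv_pos.2 hTpos
  let ι : S ↪ Fin (Fintype.card S + 1) :=
    (Fintype.equivFin S).toEmbedding.trans (Fin.succEmb _)
  let M : MAPostPFA Sym :=
    { m := Fintype.card S + 1
      Aopen := initSink T⁻¹ u
      Aclose := 1
      Acent := withSink T⁻¹ D
      Adollar := 1
      Asym := fun s => withSink T⁻¹ (W s)
      hopen := colStochastic_initSink hl.le hu (hscale _ (by linarith))
      hclose := colStochastic_one _
      hcent := colStochastic_withSink hl.le hD fun j => hscale _ (by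
        have := Finset.single_le_sum (fun j _ => hDc j) (Finset.mem_univ j)
        linarith)
      hdollar := colStochastic_one _
      hsym := fun s => colStochastic_withSink hl.le (hW s) fun j => hscale _ (by
        have h₁ := Finset.single_le_sum (fun j _ => hWc s j) (Finset.mem_univ j)
        have h₂ := Finset.single_le_sum (fun s _ => hWs s) (Finset.mem_univ s)
        linarith)
      Facc := acc.map ι
      Frej := rej.map ι
      disj := (Finset.disjoint_map ι).2 hd }
  let κ : List Sym → List Sym → ℝ :=
    fun c x => T⁻¹ * T⁻¹ ^ c.length * T⁻¹ * T⁻¹ ^ x.length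
  have key : ∀ c x s, M.finalVec c x (ι s) = κ c x * run W (D.mulVec (run W u c)) x s := by
    intro c x s
    simp only [finalVec, M, Matrix.one_mulVec]
    exact foldl_withSink W x
      (withSink_mulVec (foldl_withSink W c fun s => initSink_mulVec T⁻¹ u s)) s
  refine ⟨M, κ, fun c x => by positivity, fun c x => ?_, fun c x => ?_⟩
  · rw [aPr, Finset.mul_sum]
    exact (Finset.sum_map _ _ _).trans (Finset.sum_congr rfl fun s _ => key c x s)
  · rw [rPr, Finset.mul_sum]
    exact (Finset.sum_map _ _ _).trans (Finset.sum_congr rfl fun s _ => key c x s)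

lemma run_append (W : Sym → Matrix S S ℝ) (v : S → ℝ) (c d : List Sym) :
    run W v (c ++ d) = run W (run W v c) d :=
  List.foldl_append

lemma run_fromBlocks {S' : Type} [Fintype S'] (A : Sym → Matrix S S ℝ) (B : Sym → Matrix S' S' ℝ)
    (u : S → ℝ) (v : S' → ℝ) (c : List Sym) :
    run (fun s => Matrix.fromBlocks (A s) 0 0 (B s)) (Sum.elim u v) c =
      Sum.elim (run A u c) (run B v c) := by
  induction c generalizing u v with
  | nil => rfl
  | cons a c ih =>
    have h : (Matrix.fromBlocks (A a) 0 0 (B a)).mulVec (Sum.elim u v) =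
        Sum.elim ((A a).mulVec u) ((B a).mulVec v) := by
      rw [Matrix.fromBlocks_mulVec]
      simp
    simpa only [run, List.foldl_cons, h] using ih _ _

lemma run_replicate_diagonal [DecidableEq S] {W : Sym → Matrix S S ℝ} {a : Sym} {d : S → ℝ}
    (h : W a = Matrix.diagonal d) (v : S → ℝ) (n : ℕ) (s : S) :
    run W v (List.replicate n a) s = d s ^ n * v s := by
  induction n generalizing v with
  | zero => simp [run]
  | succ n ih =>
    have := ih ((W a).mulVec v)
    rw [h, Matrix.mulVec_diagonal] at this
    rw [← h] at this
    simp only [run, List.replicate_succ, List.foldl_cons] at this ⊢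
    rw [this]
    ring

end Realization

section Blocks

/-- The word `a^{i_1} b a^{i_2} b ⋯ a^{i_k} b` for the list `[i_k, …, i_1]`. -/
def encode : List ℕ → List Bool
  | [] => []
  | i :: l => encode l ++ (List.replicate i false ++ [true])

lemma exists_encode (c : List Bool) : ∃ l t, c = encode l ++ List.replicate t false := by
  induction c using List.reverseRecOn with
  | nil => exact ⟨[], 0, rfl⟩
  | append_singleton c s ih =>
    obtain ⟨l, t, rfl⟩ := ih
    cases s
    · exact ⟨l, t + 1, by rw [List.replicate_succ', List.append_assoc]⟩
    · exact ⟨t :: l, 0, by simp [encode]⟩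

lemma flatten_replicate_eq_encode (i j : ℕ) :
    (List.replicate j (List.replicate i false ++ [true])).flatten =
      encode (List.replicate j i) := by
  induction j with
  | zero => rfl
  | succ j ih =>
    rw [List.replicate_succ', List.flatten_append, ih, List.replicate_succ, encode]
    simp

/-- The product of the sums `64 ^ i + 64 ^ j` over neighbouring entries `i, j` of `m :: l`. -/
def sumProd : List ℕ → ℕ → ℝ
  | [], _ => 1
  | i :: l, m => sumProd l i * (64 ^ i + 64 ^ m)

/-- The product of the terms `2 * (8 ^ i * 8 ^ j)` over neighbouring entries `i, j` of `m :: l`. -/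
def geomProd : List ℕ → ℕ → ℝ
  | [], _ => 1
  | i :: l, m => geomProd l i * (2 * (8 ^ i * 8 ^ m))

lemma pow_sixtyfour (i : ℕ) : (64 : ℝ) ^ i = (8 ^ i) ^ 2 := by
  rw [← pow_mul, mul_comm, pow_mul]; norm_num

lemma two_mul_le_add_pow (i j : ℕ) : 2 * ((8 : ℝ) ^ i * 8 ^ j) ≤ 64 ^ i + 64 ^ j := by
  rw [pow_sixtyfour, pow_sixtyfour]
  nlinarith [sq_nonneg ((8 : ℝ) ^ i - 8 ^ j)]

lemma eight_mul_le_add_pow {i j : ℕ} (h : i ≠ j) :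
    8 * ((8 : ℝ) ^ i * 8 ^ j) ≤ 64 ^ i + 64 ^ j := by
  wlog hij : i < j generalizing i j
  · linarith [this h.symm (by omega)]
  have h₁ : (8 : ℝ) * 8 ^ i ≤ 8 ^ j := by
    rw [← pow_succ']
    exact pow_le_pow_right₀ (by norm_num) hij
  rw [pow_sixtyfour, pow_sixtyfour]
  have h₂ : (0 : ℝ) < 8 ^ i := by positivity
  have h₃ : (0 : ℝ) < 8 ^ j := by positivity
  nlinarith

lemma geomProd_pos (l : List ℕ) (m : ℕ) : 0 < geomProd l m := by
  induction l generalizing m with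
  | nil => exact one_pos
  | cons i l ih => exact mul_pos (ih i) (by positivity)

lemma geomProd_le_sumProd (l : List ℕ) (m : ℕ) : geomProd l m ≤ sumProd l m := by
  induction l generalizing m with
  | nil => exact le_rfl
  | cons i l ih =>
    exact mul_le_mul (ih i) (two_mul_le_add_pow i m) (by positivity)
      ((geomProd_pos l i).le.trans (ih i))

lemma sumProd_pos (l : List ℕ) (m : ℕ) : 0 < sumProd l m :=
  (geomProd_pos l m).trans_le (geomProd_le_sumProd l m)

lemma four_mul_geomProd_le {l : List ℕ} {m : ℕ} (h : ¬ ∀ i ∈ l, i = m) :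
    4 * geomProd l m ≤ sumProd l m := by
  induction l generalizing m with
  | nil => simp at h
  | cons i l ih =>
    have hg := geomProd_pos l i
    simp only [geomProd, sumProd]
    by_cases him : i = m
    · subst him
      have h' : ¬ ∀ j ∈ l, j = i := by simpa using h
      have := mul_le_mul (ih h') (two_mul_le_add_pow i i) (by positivity) (sumProd_pos l i).le
      linarith
    · have := mul_le_mul (geomProd_le_sumProd l i) (eight_mul_le_add_pow him) (by positivity)
        (sumProd_pos l i).le
      linarith

lemma sumProd_eq_geomProd {l : List ℕ} {m : ℕ} (h : ∀ i ∈ l, i = m) :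
    sumProd l m = geomProd l m := by
  induction l generalizing m with
  | nil => rfl
  | cons i l ih =>
    obtain ⟨rfl, h⟩ := List.forall_mem_cons.1 h
    rw [sumProd, geomProd, ih h, pow_sixtyfour]
    ring

end Blocks

section Automata

/-- Weights of the letter `a` in the automaton `sumMat`. A state `(p, q, t, w)` records whether
the current block contributes to the factor it shares with the previous block (`p`) and to the
one it shares with the next block (`q`), whether the number of blocks contributes to its factor
(`t`), and whether the number of letters `a` contributes to its factor (`w`). -/
def sumWeight : Bool × Bool × Bool × Bool → ℝ := fun (p, q, _, w) =>
  (if p then 64 else 1) * (if q then 64 else 1) * (if w then 64 else 1)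

/-- Certificate automaton expanding `sumProd` into monomials. -/
def sumMat : Bool → Matrix (Bool × Bool × Bool × Bool) (Bool × Bool × Bool × Bool) ℝ
  | false => Matrix.diagonal sumWeight
  | true => Matrix.of fun (p', _, t', w') (_, q, t, w) =>
      if p' = !q ∧ t' = t ∧ w' = w then (if t then 64 else 1) else 0

/-- Initial vector of `sumMat`. -/
def sumInit : Bool × Bool × Bool × Bool → ℝ := fun s => if s.1 then 0 else 1

/-- Weights of the letter `a` in `geomMat`: the first block has one neighbour fewer. -/
def geomWeight (b : Bool) : ℝ := if b then 8 ^ 2 else 8 ^ 3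

/-- Certificate automaton computing `geomProd`. A state `(b, o)` records whether the current block
is the first one (`b`) and whether it has been opened by a letter `a` (`o`). -/
def geomMat : Bool → Matrix (Bool × Bool) (Bool × Bool) ℝ
  | false => Matrix.of fun (b', o') (b, _) => if b' = b ∧ o' then geomWeight b else 0
  | true => Matrix.of fun (b', o') _ => if b' ∨ o' then 0 else 16

/-- Initial vector of `geomMat`. -/
def geomInit : Bool × Bool → ℝ := fun s => if s = (true, false) then 1 else 0

/-- Weights of the input letter; the state `none` accepts, the other ones reject. -/
def inputWeight : Option Bool → ℝ
  | none => 8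
  | some true => 1
  | some false => 64

/-- Input automaton. -/
def inputMat : Bool → Matrix (Option Bool) (Option Bool) ℝ
  | false => Matrix.diagonal inputWeight
  | true => 0

/-- Transition from the certificate automata to the input automaton. -/
def transferMat : Matrix (Option Bool) ((Bool × Bool × Bool × Bool) ⊕ (Bool × Bool)) ℝ
  | none, Sum.inr (_, o) => if o then 0 else 4
  | some w, Sum.inl (p, q, t, w') => if w' = w ∧ q = false ∧ p = t then 1 else 0
  | none, Sum.inl _ => 0
  | some _, Sum.inr _ => 0

/-- Coefficients of `sumProd l m` as a polynomial in `64 ^ m`. -/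
def sumCoeff : List ℕ → Bool → ℝ
  | [], p => if p then 0 else 1
  | i :: l, p => sumProd l i * (if p then 1 else 64 ^ i)

lemma sumProd_eq_coeff (l : List ℕ) (m : ℕ) :
    sumProd l m = sumCoeff l false + sumCoeff l true * 64 ^ m := by
  cases l <;> simp [sumProd, sumCoeff, mul_add]

lemma sumCoeff_nonneg (l : List ℕ) (p : Bool) : 0 ≤ sumCoeff l p := by
  cases l with
  | nil => cases p <;> simp [sumCoeff]
  | cons i l =>
    have := sumProd_pos l i
    cases p <;> simp only [sumCoeff] <;> positivity

lemma sumMat_true_mulVec (v : Bool × Bool × Bool × Bool → ℝ) (p q t w : Bool) :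
    (sumMat true).mulVec v (p, q, t, w) =
      (if t then 64 else 1) * (v (true, !p, t, w) + v (false, !p, t, w)) := by
  cases p <;> cases t <;> cases w <;>
    simp [sumMat, Matrix.mulVec, dotProduct, Fintype.sum_prod_type, mul_add]

lemma run_sumMat_replicate (v : Bool × Bool × Bool × Bool → ℝ) (n : ℕ)
    (s : Bool × Bool × Bool × Bool) :
    run sumMat v (List.replicate n false) s = sumWeight s ^ n * v s :=
  run_replicate_diagonal (a := false) rfl v n s

lemma run_inputMat_replicate (v : Option Bool → ℝ) (n : ℕ) (s : Option Bool) :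
    run inputMat v (List.replicate n false) s = inputWeight s ^ n * v s :=
  run_replicate_diagonal (a := false) rfl v n s

lemma run_sumMat_encode (l : List ℕ) (p q t w : Bool) :
    run sumMat sumInit (encode l) (p, q, t, w) =
      sumCoeff l p * (if t then 64 ^ l.length else 1) * (if w then 64 ^ l.sum else 1) := by
  induction l generalizing p q t w with
  | nil => simp [run, encode, sumInit, sumCoeff]
  | cons i l ih =>
    rw [encode, run_append, run_append]
    change (sumMat true).mulVec _ _ = _
    rw [sumMat_true_mulVec, run_sumMat_replicate, run_sumMat_replicate, ih, ih, sumCoeff,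
      sumProd_eq_coeff]
    cases p <;> cases t <;> cases w <;>
      simp [sumWeight, mul_pow, pow_succ, pow_add] <;> ring

lemma geomMat_false_mulVec (v : Bool × Bool → ℝ) (b o : Bool) :
    (geomMat false).mulVec v (b, o) =
      if o then geomWeight b * (v (b, true) + v (b, false)) else 0 := by
  cases b <;> cases o <;>
    simp [geomMat, Matrix.mulVec, dotProduct, Fintype.sum_prod_type, mul_add]

lemma geomMat_true_mulVec (v : Bool × Bool → ℝ) (b o : Bool) :
    (geomMat true).mulVec v (b, o) = if b ∨ o then 0 else
      16 * (v (true, true) + v (true, false) + (v (false, true) + v (false, false))) := by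
  cases b <;> cases o <;>
    simp [geomMat, Matrix.mulVec, dotProduct, Fintype.sum_prod_type, mul_add]

lemma run_geomMat_replicate (v : Bool × Bool → ℝ) (n : ℕ) (b : Bool) :
    run geomMat v (List.replicate n false) (b, true) +
        run geomMat v (List.replicate n false) (b, false) =
      geomWeight b ^ n * (v (b, true) + v (b, false)) := by
  induction n with
  | zero => simp [run]
  | succ n ih =>
    rw [List.replicate_succ', run_append]
    change (geomMat false).mulVec _ _ + (geomMat false).mulVec _ _ = _
    rw [geomMat_false_mulVec, geomMat_false_mulVec, if_pos rfl, ih]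
    simp only [Bool.false_eq_true, if_false]
    ring

lemma run_geomMat_open (v : Bool × Bool → ℝ) (c : List Bool) (b : Bool) :
    run geomMat v (c ++ [false]) (b, false) = 0 := by
  rw [run_append]
  change (geomMat false).mulVec _ _ = _
  simp [geomMat_false_mulVec]

lemma run_geomMat_encode (l : List ℕ) (b o : Bool) :
    run geomMat geomInit (encode l) (b, o) =
      if b = l.isEmpty ∧ o = false then geomProd l l.length * 8 ^ l.sum else 0 := by
  induction l generalizing b o with
  | nil => simp [run, encode, geomInit, geomProd]
  | cons i l ih =>
    rw [encode, run_append, run_append]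
    change (geomMat true).mulVec _ _ = _
    rw [geomMat_true_mulVec, run_geomMat_replicate, run_geomMat_replicate]
    simp only [ih]
    cases l <;> cases b <;> cases o <;>
      simp [geomWeight, geomProd, pow_succ, pow_add, mul_pow] <;> ring

end Automata

end MAPostPFA

open MAPostPFA in
/-- There is an automaton whose accepting and rejecting weights are, up to a common positive factor,
the products that detect squares. -/
theorem exists_square_weights : ∃ (M : MAPostPFA Bool) (κ : List Bool → List Bool → ℝ),
    (∀ c x, 0 < κ c x) ∧
    (∀ l n, M.aPr (encode l) (List.replicate n false) = κ (encode l) (List.replicate n false) *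
      (4 * (geomProd l l.length * (8 ^ l.sum * 8 ^ n)))) ∧
    (∀ l n, M.rPr (encode l) (List.replicate n false) = κ (encode l) (List.replicate n false) *
      (sumProd l l.length * (64 ^ l.sum + 64 ^ n))) ∧
    (∀ c n, M.aPr (c ++ [false]) (List.replicate n false) = 0) ∧
    (∀ c n, 0 < M.rPr c (List.replicate n false)) := by
  obtain ⟨M, κ, hκ, ha, hr⟩ := exists_realization
    (Sum.elim (Sum.elim sumInit geomInit) (0 : Option Bool → ℝ))
    (fun s => Matrix.fromBlocks (Matrix.fromBlocks (sumMat s) 0 0 (geomMat s)) 0 0 (inputMat s))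
    (Matrix.fromBlocks 0 0 transferMat 0) {Sum.inr none}
    {Sum.inr (some true), Sum.inr (some false)} (by simp)
    (by
      rintro ((s | s) | s)
      · simp only [Sum.elim_inl, sumInit]; split_ifs <;> norm_num
      · simp only [Sum.elim_inl, Sum.elim_inr, geomInit]; split_ifs <;> norm_num
      · simp)
    (by
      rintro s ((i | i) | i) ((j | j) | j) <;> try exact le_rfl
      · cases s
        · simp only [Matrix.fromBlocks_apply₁₁, sumMat, Matrix.diagonal_apply, sumWeight]
          split_ifs <;> norm_num
        · simp only [Matrix.fromBlocks_apply₁₁, sumMat, Matrix.of_apply]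
          split_ifs <;> norm_num
      · cases s
        · simp only [Matrix.fromBlocks_apply₁₁, Matrix.fromBlocks_apply₂₂, geomMat,
            Matrix.of_apply, geomWeight]
          split_ifs <;> norm_num
        · simp only [Matrix.fromBlocks_apply₁₁, Matrix.fromBlocks_apply₂₂, geomMat,
            Matrix.of_apply]
          split_ifs <;> norm_num
      · cases s
        · simp only [Matrix.fromBlocks_apply₂₂, inputMat, Matrix.diagonal_apply]
          rcases i with _ | _ | _ <;> simp only [inputWeight] <;> split_ifs <;> norm_num
        · exact le_rfl)
    (by
      rintro (i | i) (j | j) <;> try exact le_rfl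
      rcases i with _ | i <;> rcases j with j | j <;>
        simp only [Matrix.fromBlocks_apply₂₁, transferMat] <;> (try split_ifs) <;> norm_num)
  have hmid : ∀ c : List Bool, (Matrix.fromBlocks 0 0 transferMat 0).mulVec
      (run (fun s => Matrix.fromBlocks (Matrix.fromBlocks (sumMat s) 0 0 (geomMat s)) 0 0
        (inputMat s)) (Sum.elim (Sum.elim sumInit geomInit) (0 : Option Bool → ℝ)) c) =
      Sum.elim (0 : (Bool × Bool × Bool × Bool) ⊕ (Bool × Bool) → ℝ) (transferMat.mulVec
        (Sum.elim (run sumMat sumInit c) (run geomMat geomInit c))) := by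
    intro c
    rw [run_fromBlocks, run_fromBlocks, Matrix.fromBlocks_mulVec]
    simp
  have hnone : ∀ c, transferMat.mulVec
      (Sum.elim (run sumMat sumInit c) (run geomMat geomInit c)) none =
      4 * (run geomMat geomInit c (true, false) + run geomMat geomInit c (false, false)) := by
    intro c
    simp [Matrix.mulVec, dotProduct, transferMat, Fintype.sum_prod_type, mul_add]
  have hsome : ∀ c w, transferMat.mulVec
      (Sum.elim (run sumMat sumInit c) (run geomMat geomInit c)) (some w) =
      run sumMat sumInit c (true, false, true, w) +
        run sumMat sumInit c (false, false, false, w) := by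
    intro c w
    cases w <;> simp [Matrix.mulVec, dotProduct, transferMat, Fintype.sum_prod_type]
  have ha' : ∀ c n, M.aPr c (List.replicate n false) = κ c (List.replicate n false) *
      (8 ^ n * (4 * (run geomMat geomInit c (true, false) +
        run geomMat geomInit c (false, false)))) := by
    intro c n
    rw [ha, Finset.sum_singleton, hmid, run_fromBlocks, Sum.elim_inr,
      run_inputMat_replicate, hnone, inputWeight]
  have hr' : ∀ c n, M.rPr c (List.replicate n false) = κ c (List.replicate n false) *
      ((run sumMat sumInit c (true, false, true, true) +
        run sumMat sumInit c (false, false, false, true)) +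
      64 ^ n * (run sumMat sumInit c (true, false, true, false) +
        run sumMat sumInit c (false, false, false, false))) := by
    intro c n
    rw [hr, Finset.sum_pair (by simp), hmid, run_fromBlocks, Sum.elim_inr, Sum.elim_inr,
      run_inputMat_replicate,
      run_inputMat_replicate, hsome, hsome]
    simp [inputWeight]
  refine ⟨M, κ, hκ, fun l n => ?_, fun l n => ?_, fun c n => ?_, fun c n => ?_⟩
  · rw [ha', run_geomMat_encode, run_geomMat_encode]
    congr 1
    cases l <;> simp <;> ring
  · rw [hr', run_sumMat_encode, run_sumMat_encode, run_sumMat_encode, run_sumMat_encode,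
      sumProd_eq_coeff]
    congr 1
    simp
    ring
  · rw [ha', run_geomMat_open, run_geomMat_open]
    simp
  · rw [hr']
    obtain ⟨l, t, rfl⟩ := exists_encode c
    refine mul_pos (hκ _ _) ?_
    simp only [run_append, run_sumMat_replicate,
      run_sumMat_encode]
    have h₀ := sumCoeff_nonneg l false
    have h₁ := sumCoeff_nonneg l true
    have h : 0 < sumCoeff l false + sumCoeff l true := by
      simpa [sumProd_eq_coeff] using sumProd_pos l 0
    simp only [sumWeight, if_true, if_false, Bool.false_eq_true, mul_one, one_mul, one_pow]
    rcases h₀.lt_or_eq with h' | h'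
    · positivity
    · have : 0 < sumCoeff l true := by linarith
      positivity

/-- an MA-PostPFA with certificate alphabet `{a,b}` (encoded as `Bool`, with
`a = false`, `b = true`) and input alphabet `{a}` verifies `USQUARE` with bounded error;
for input `a^(i²)` the certificate `(a^i b)^i` (flattened) of length `i² + i` suffices. -/
theorem mapostpfa_usquare :
    ∃ (ε : ℝ) (M : MAPostPFA Bool),
      ε < 1 / 2 ∧
      (∀ (c : List Bool) (n : ℕ),
        0 < M.aPr c (List.replicate n false) + M.rPr c (List.replicate n false)) ∧
      (∀ i : ℕ,
        1 - ε ≤ M.accProb ((List.replicate i (List.replicate i false ++ [true])).flatten)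
            (List.replicate (i ^ 2) false)) ∧
      (∀ n : ℕ, (¬ ∃ i : ℕ, n = i ^ 2) → ∀ c : List Bool,
        1 - ε ≤ M.rejProb c (List.replicate n false)) := by
  obtain ⟨M, κ, hκ, ha, hr, ha₀, hr₀⟩ := exists_square_weights
  have hpos : ∀ (c : List Bool) (n : ℕ),
      0 < M.aPr c (List.replicate n false) + M.rPr c (List.replicate n false) := by
    intro c n
    refine add_pos_of_nonneg_of_pos ?_ (hr₀ c n)
    obtain ⟨l, t, rfl⟩ := MAPostPFA.exists_encode c
    cases t with
    | zero =>
      have h₁ := hκ (MAPostPFA.encode l) (List.replicate n false)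
      have h₂ := MAPostPFA.geomProd_pos l l.length
      rw [List.replicate_zero, List.append_nil, ha]
      positivity
    | succ t => rw [List.replicate_succ', ← List.append_assoc, ha₀]
  refine ⟨1 / 3, M, by norm_num, hpos, fun i => ?_, fun n hn c => ?_⟩
  · have hp := hpos (MAPostPFA.encode (List.replicate i i)) (i ^ 2)
    rw [MAPostPFA.flatten_replicate_eq_encode, MAPostPFA.accProb, le_div_iff₀ hp, ha, hr,
      MAPostPFA.sumProd_eq_geomProd (by simp), List.sum_replicate, smul_eq_mul, ← sq,
      MAPostPFA.pow_sixtyfour]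
    apply le_of_eq
    ring
  · rw [MAPostPFA.rejProb, le_div_iff₀ (hpos c n)]
    obtain ⟨l, t, rfl⟩ := MAPostPFA.exists_encode c
    cases t with
    | zero =>
      rw [List.replicate_zero, List.append_nil, ha, hr]
      suffices h : 8 * (MAPostPFA.geomProd l l.length * (8 ^ l.sum * 8 ^ n)) ≤
          MAPostPFA.sumProd l l.length * (64 ^ l.sum + 64 ^ n) by
        have := mul_le_mul_of_nonneg_left h
          (hκ (MAPostPFA.encode l) (List.replicate n false)).le
        linarith
      have hg := MAPostPFA.geomProd_pos l l.length
      have hs := MAPostPFA.sumProd_pos l l.length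
      by_cases hl : ∀ i ∈ l, i = l.length
      · have hsum : l.sum ≠ n := by
          rintro rfl
          refine hn ⟨l.length, ?_⟩
          rw [List.sum_eq_card_nsmul l _ hl, smul_eq_mul, sq]
        have := mul_le_mul (MAPostPFA.geomProd_le_sumProd l l.length)
          (MAPostPFA.eight_mul_le_add_pow hsum) (by positivity) hs.le
        linarith
      · have := mul_le_mul (MAPostPFA.four_mul_geomProd_le hl)
          (MAPostPFA.two_mul_le_add_pow l.sum n) (by positivity) hs.le
        linarith
    | succ t =>
      have := hr₀ (MAPostPFA.encode l ++ List.replicate (t + 1) false) n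
      rw [List.replicate_succ', ← List.append_assoc] at this ⊢
      rw [ha₀]
      linarith
end

section
/- For every integer k ≥ 2 there exist ε < 1/2, a constant C, and an MA-PostPFA M with a finite certificate alphabet and input alphabet {a} such that: a(c,x)+r(c,x) > 0 for all certificates and inputs; for every i ≥ 0, on input a^(i^k) some certificate of length at most C·(i^k + 1) gives acceptance probability at least 1−ε; and for every n that is not a k-th power and every certificate c, the rejection probability is at least 1−ε. Hence M verifies UPOLY(k) = { a^(i^k) : i ≥ 0 } with bounded error using linear-size certificates. -/
open Matrix

/-! ### Weighted automata with nonnegative weights -/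

/-- `f` is computed by a weighted automaton with nonnegative real weights. -/
def NonnegRecognizable {S : Type} (f : List S → ℝ) : Prop :=
  ∃ (ι : Type) (_ : Fintype ι) (u v : ι → ℝ) (M : S → Matrix ι ι ℝ),
    (∀ i, 0 ≤ u i) ∧ (∀ i, 0 ≤ v i) ∧ (∀ s i j, 0 ≤ M s i j) ∧
      ∀ w, f w = v ⬝ᵥ w.foldl (fun x s => M s *ᵥ x) u

namespace NonnegRecognizable

variable {S : Type}

lemma foldl_fromBlocks {ι κ : Type} [Fintype ι] [Fintype κ] (M : S → Matrix ι ι ℝ)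
    (N : S → Matrix κ κ ℝ) (w : List S) (x : ι → ℝ) (y : κ → ℝ) :
    w.foldl (fun z s => Matrix.fromBlocks (M s) 0 0 (N s) *ᵥ z) (Sum.elim x y) =
      Sum.elim (w.foldl (fun z s => M s *ᵥ z) x) (w.foldl (fun z s => N s *ᵥ z) y) := by
  induction w generalizing x y with
  | nil => rfl
  | cons s w ih =>
    rw [List.foldl_cons, Matrix.fromBlocks_mulVec]
    simpa using ih _ _

lemma add {f g : List S → ℝ} (hf : NonnegRecognizable f) (hg : NonnegRecognizable g) :
    NonnegRecognizable (fun w => f w + g w) := by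
  obtain ⟨ι, _, u, v, M, hu, hv, hM, hf⟩ := hf
  obtain ⟨κ, _, u', v', N, hu', hv', hN, hg⟩ := hg
  refine ⟨ι ⊕ κ, inferInstance, Sum.elim u u', Sum.elim v v',
    fun s => Matrix.fromBlocks (M s) 0 0 (N s), ?_, ?_, ?_, ?_⟩
  · rintro (i | i)
    exacts [hu i, hu' i]
  · rintro (i | i)
    exacts [hv i, hv' i]
  · rintro s (i | i) (j | j)
    exacts [hM s i j, le_rfl, le_rfl, hN s i j]
  · intro w
    simp only [foldl_fromBlocks, sumElim_dotProduct_sumElim, hf, hg]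

lemma const_mul {f : List S → ℝ} (hf : NonnegRecognizable f) {a : ℝ} (ha : 0 ≤ a) :
    NonnegRecognizable (fun w => a * f w) := by
  obtain ⟨ι, _, u, v, M, hu, hv, hM, hf⟩ := hf
  refine ⟨ι, inferInstance, u, a • v, M, hu, fun i => mul_nonneg ha (hv i), hM, fun w => ?_⟩
  simp only [smul_dotProduct, hf, smul_eq_mul]

lemma prod_map {g : S → ℝ} (hg : ∀ s, 0 ≤ g s) :
    NonnegRecognizable (fun w => (w.map g).prod) := by
  refine ⟨Unit, inferInstance, 1, 1, fun s => Matrix.of fun _ _ => g s, fun _ => zero_le_one,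
    fun _ => zero_le_one, fun s _ _ => hg s, fun w => ?_⟩
  have key : ∀ (w : List S) (y : ℝ),
      w.foldl (fun (x : Unit → ℝ) s => (Matrix.of fun _ _ => g s) *ᵥ x) (fun _ => y) =
        fun _ => y * (w.map g).prod := by
    intro w
    induction w with
    | nil => simp
    | cons s w ih =>
      intro y
      have : (Matrix.of fun _ _ : Unit => g s) *ᵥ (fun _ => y) = fun _ => y * g s := by
        ext; simp [Matrix.mulVec, dotProduct, mul_comm]
      rw [List.foldl_cons, this, ih]
      simp [mul_assoc]
  have := key w 1
  rw [show (1 : Unit → ℝ) = fun _ => 1 from rfl, this]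
  simp [dotProduct]

lemma const {a : ℝ} (ha : 0 ≤ a) : NonnegRecognizable (fun _ : List S => a) := by
  simpa using (prod_map (S := S) (g := fun _ => 1) fun _ => zero_le_one).const_mul ha

lemma sum {α : Type} (t : Finset α) {f : α → List S → ℝ}
    (hf : ∀ a ∈ t, NonnegRecognizable (f a)) :
    NonnegRecognizable (fun w => ∑ a ∈ t, f a w) := by
  classical
  induction t using Finset.induction_on with
  | empty => simpa using const (S := S) le_rfl
  | insert a t ha ih =>
    simp only [Finset.sum_insert ha]
    exact (hf a (by simp)).add (ih fun b hb => hf b (by simp [hb]))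

end NonnegRecognizable

/-! ### Normalizing weighted automata to stochastic ones -/

section Completion

variable {K : Type} [Fintype K]

/-- Completion of a substochastic matrix to a stochastic one by an absorbing sink `none`. -/
def sinkCompletion (N : Matrix K K ℝ) : Matrix (Option K) (Option K) ℝ :=
  Matrix.of fun i j => match i, j with
    | some i, some j => N i j
    | none, some j => 1 - ∑ i, N i j
    | some _, none => 0
    | none, none => 1

lemma sinkCompletion_nonneg {N : Matrix K K ℝ} (h0 : ∀ i j, 0 ≤ N i j)
    (h1 : ∀ j, ∑ i, N i j ≤ 1) : ∀ i j, 0 ≤ sinkCompletion N i j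
  | some i, some j => h0 i j
  | none, some j => sub_nonneg.2 (h1 j)
  | some _, none => le_rfl
  | none, none => zero_le_one

lemma sum_sinkCompletion (N : Matrix K K ℝ) (j : Option K) :
    ∑ i, sinkCompletion N i j = 1 := by
  cases j <;> simp [Fintype.sum_option, sinkCompletion]

lemma sinkCompletion_mulVec_some (N : Matrix K K ℝ) (x : Option K → ℝ) :
    (sinkCompletion N *ᵥ x) ∘ some = N *ᵥ (x ∘ some) := by
  ext i
  simp [Matrix.mulVec, dotProduct, Fintype.sum_option, sinkCompletion]

lemma colStochastic_submatrix {J : Type} [Fintype J] {m : ℕ} (e : J ≃ Fin m)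
    {A : Matrix J J ℝ} (h0 : ∀ i j, 0 ≤ A i j) (h1 : ∀ j, ∑ i, A i j = 1) :
    ColStochastic (A.submatrix e.symm e.symm) :=
  ⟨fun _ _ => h0 _ _, fun j => by
    simpa using (Equiv.sum_comp e.symm (fun i => A i (e.symm j))).trans (h1 _)⟩

lemma foldl_submatrix {S J : Type} [Fintype J] {m : ℕ} (e : J ≃ Fin m)
    (A : S → Matrix J J ℝ) (w : List S) (x : J → ℝ) :
    w.foldl (fun v s => (A s).submatrix e.symm e.symm *ᵥ v) (x ∘ e.symm) =
      (w.foldl (fun v s => A s *ᵥ v) x) ∘ e.symm := by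
  induction w generalizing x with
  | nil => rfl
  | cons s w ih =>
    rw [List.foldl_cons, Matrix.submatrix_mulVec_equiv, List.foldl_cons, ← ih]
    simp [Function.comp_assoc]

lemma foldl_sinkCompletion {S : Type} (N : S → Matrix K K ℝ) (w : List S)
    (x : Option K → ℝ) :
    (w.foldl (fun v s => sinkCompletion (N s) *ᵥ v) x) ∘ some =
      w.foldl (fun v s => N s *ᵥ v) (x ∘ some) := by
  induction w generalizing x with
  | nil => rfl
  | cons s w ih => rw [List.foldl_cons, ih, sinkCompletion_mulVec_some, List.foldl_cons]

end Completion

lemma foldl_smul_mulVec {S ι : Type} [Fintype ι] (κ : ℝ) (M : S → Matrix ι ι ℝ)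
    (w : List S) (a : ℝ) (x : ι → ℝ) :
    w.foldl (fun v s => (κ • M s) *ᵥ v) (a • x) =
      (a * κ ^ w.length) • w.foldl (fun v s => M s *ᵥ v) x := by
  induction w generalizing a x with
  | nil => simp
  | cons s w ih =>
    rw [List.foldl_cons, Matrix.smul_mulVec, Matrix.mulVec_smul, smul_smul, ih]
    rw [List.length_cons, List.foldl_cons, pow_succ', mul_assoc, mul_left_comm]

lemma sum_e1 {m : ℕ} (hm : 0 < m) : ∑ j, e1 m j = 1 := by
  obtain ⟨m, rfl⟩ := Nat.exists_eq_succ_of_ne_zero hm.ne'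
  simp [e1]

/-- Two nonnegative recognizable series are, up to a common positive factor, the accepting and
the rejecting weight of an MA-PostPFA. -/
theorem exists_mapostpfa {S : Type} [Finite S] {f g : List S → ℝ}
    (hf : NonnegRecognizable f) (hg : NonnegRecognizable g) :
    ∃ M : MAPostPFA S, ∀ c x, ∃ a : ℝ, 0 < a ∧
      M.aPr c x = a * f (c ++ x) ∧ M.rPr c x = a * g (c ++ x) := by
  classical
  have := Fintype.ofFinite S
  obtain ⟨ι₁, _, u₁, v₁, M₁, hu₁, hv₁, hM₁, hf⟩ := hf
  obtain ⟨ι₂, _, u₂, v₂, M₂, hu₂, hv₂, hM₂, hg⟩ := hg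
  obtain ⟨ι, _, u, v, M, hu, hv, hM, hfg⟩ :
      ∃ (ι : Type) (_ : Fintype ι) (u : ι → ℝ) (v : Bool → ι → ℝ) (M : S → Matrix ι ι ℝ),
        (∀ i, 0 ≤ u i) ∧ (∀ b i, 0 ≤ v b i) ∧ (∀ s i j, 0 ≤ M s i j) ∧
        ∀ b w, (bif b then f w else g w) = v b ⬝ᵥ w.foldl (fun x s => M s *ᵥ x) u := by
    refine ⟨ι₁ ⊕ ι₂, inferInstance, Sum.elim u₁ u₂,
      fun b => bif b then Sum.elim v₁ 0 else Sum.elim 0 v₂,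
      fun s => Matrix.fromBlocks (M₁ s) 0 0 (M₂ s), ?_, ?_, ?_, ?_⟩
    · rintro (i | i)
      exacts [hu₁ i, hu₂ i]
    · rintro (_ | _) (i | i)
      exacts [le_rfl, hv₂ i, hv₁ i, le_rfl]
    · rintro s (i | i) (j | j)
      exacts [hM₁ s i j, le_rfl, le_rfl, hM₂ s i j]
    · intro b w
      rw [NonnegRecognizable.foldl_fromBlocks]
      cases b <;> simp [sumElim_dotProduct_sumElim, hf, hg]
  obtain ⟨κ, hκ, hκu, hκv, hκM⟩ : ∃ κ : ℝ, 0 < κ ∧ κ * ∑ i, u i ≤ 1 ∧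
      (∀ j, κ * ∑ b, v b j ≤ 1) ∧ ∀ s j, κ * ∑ i, M s i j ≤ 1 := by
    have h1 : 0 ≤ ∑ i, u i := Finset.sum_nonneg fun i _ => hu i
    have h2 : ∀ j, 0 ≤ ∑ b, v b j := fun j => Finset.sum_nonneg fun b _ => hv b j
    have h3 : ∀ s j, 0 ≤ ∑ i, M s i j := fun s j => Finset.sum_nonneg fun i _ => hM s i j
    have h2' : 0 ≤ ∑ j, ∑ b, v b j := Finset.sum_nonneg fun j _ => h2 j
    have h3' : ∀ s, 0 ≤ ∑ j, ∑ i, M s i j := fun s => Finset.sum_nonneg fun j _ => h3 s j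
    have h3'' : 0 ≤ ∑ s, ∑ j, ∑ i, M s i j := Finset.sum_nonneg fun s _ => h3' s
    set T : ℝ := 1 + ∑ i, u i + ∑ j, ∑ b, v b j + ∑ s, ∑ j, ∑ i, M s i j with hT
    have hT0 : 0 < T := by positivity
    have aux : ∀ y ≤ T, T⁻¹ * y ≤ 1 := fun y hy => by
      rw [inv_mul_le_iff₀ hT0]
      linarith
    refine ⟨T⁻¹, inv_pos.2 hT0, aux _ (by linarith), fun j => aux _ ?_, fun s j => aux _ ?_⟩
    · have := Finset.single_le_sum (fun j _ => h2 j) (Finset.mem_univ j)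
      linarith
    · have h := Finset.single_le_sum (fun j _ => h3 s j) (Finset.mem_univ j)
      have h' := Finset.single_le_sum (fun s _ => h3' s) (Finset.mem_univ s)
      linarith
  let p : Option (ι ⊕ Bool) → ℝ := fun o => o.elim (1 - κ * ∑ i, u i) (Sum.elim (κ • u) 0)
  let N : S → Matrix (ι ⊕ Bool) (ι ⊕ Bool) ℝ := fun s => Matrix.fromBlocks (κ • M s) 0 0 0
  let L : Matrix (ι ⊕ Bool) (ι ⊕ Bool) ℝ := Matrix.fromBlocks 0 0 (κ • Matrix.of v) 0
  let m := Fintype.card (Option (ι ⊕ Bool))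
  let e : Option (ι ⊕ Bool) ≃ Fin m := Fintype.equivFin _
  have hN0 : ∀ s i j, 0 ≤ N s i j := by
    rintro s (i | i) (j | j)
    exacts [mul_nonneg hκ.le (hM s i j), le_rfl, le_rfl, le_rfl]
  have hN1 : ∀ s j, ∑ i, N s i j ≤ 1 := by
    rintro s (j | j)
    · simpa [N, ← Finset.mul_sum] using hκM s j
    · simp [N]
  have hL0 : ∀ i j, 0 ≤ L i j := by
    rintro (i | i) (j | j)
    exacts [le_rfl, le_rfl, mul_nonneg hκ.le (hv i j), le_rfl]
  have hL1 : ∀ j, ∑ i, L i j ≤ 1 := by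
    rintro (j | j)
    · simpa [L, mul_add] using hκv j
    · simp [L]
  have hp0 : ∀ i, 0 ≤ p i := by
    rintro (_ | i | i)
    exacts [sub_nonneg.2 hκu, mul_nonneg hκ.le (hu i), le_rfl]
  have hp1 : ∑ i, p i = 1 := by
    simp [p, Fintype.sum_option, ← Finset.mul_sum]
  refine ⟨{ m := m
            Aopen := (Matrix.of fun i _ => p i).submatrix e.symm e.symm
            Aclose := 1
            Acent := 1
            Adollar := (sinkCompletion L).submatrix e.symm e.symm
            Asym := fun s => (sinkCompletion (N s)).submatrix e.symm e.symm
            hopen := colStochastic_submatrix e (fun i _ => hp0 i) fun _ => hp1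
            hclose := ⟨fun i j => by rw [Matrix.one_apply]; split_ifs <;> norm_num,
              fun j => by simp [Matrix.one_apply]⟩
            hcent := ⟨fun i j => by rw [Matrix.one_apply]; split_ifs <;> norm_num,
              fun j => by simp [Matrix.one_apply]⟩
            hdollar := colStochastic_submatrix e (sinkCompletion_nonneg hL0 hL1)
              (sum_sinkCompletion L)
            hsym := fun s => colStochastic_submatrix e (sinkCompletion_nonneg (hN0 s) (hN1 s))
              (sum_sinkCompletion (N s))
            Facc := {e (some (Sum.inr true))}
            Frej := {e (some (Sum.inr false))}
            disj := by simp }, fun c x => ⟨κ ^ ((c ++ x).length + 2), by positivity, ?_⟩⟩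
  have hinit : (Matrix.of fun i _ => p i).submatrix e.symm e.symm *ᵥ e1 m = p ∘ e.symm := by
    ext i
    have hm : 0 < m := Fintype.card_pos
    simp [Matrix.mulVec, dotProduct, ← Finset.mul_sum, sum_e1 hm]
  have hfinal : ∀ b : Bool,
      ((sinkCompletion L).submatrix e.symm e.symm *ᵥ
        (c ++ x).foldl (fun v s => (sinkCompletion (N s)).submatrix e.symm e.symm *ᵥ v)
          (p ∘ e.symm)) (e (some (Sum.inr b))) =
      κ ^ ((c ++ x).length + 2) * bif b then f (c ++ x) else g (c ++ x) := by
    intro b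
    rw [foldl_submatrix, Matrix.submatrix_mulVec_equiv]
    have h1 := congrFun (sinkCompletion_mulVec_some L
      ((c ++ x).foldl (fun v s => sinkCompletion (N s) *ᵥ v) p)) (Sum.inr b)
    have h2 : p ∘ some = Sum.elim (κ • u) 0 := rfl
    have h3 := NonnegRecognizable.foldl_fromBlocks (fun s => κ • M s)
      (fun _ => (0 : Matrix Bool Bool ℝ)) (c ++ x) (κ • u) 0
    rw [foldl_sinkCompletion, h2] at h1
    simp only [N] at h1
    rw [h3, foldl_smul_mulVec] at h1
    simp only [Function.comp_def, Equiv.symm_symm, Equiv.symm_apply_apply] at h1 ⊢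
    rw [h1, hfg]
    simp only [L, Matrix.fromBlocks_mulVec, Matrix.smul_mulVec]
    simp [Matrix.mulVec]
    ring
  simp only [MAPostPFA.aPr, MAPostPFA.rPr, MAPostPFA.finalVec, Finset.sum_singleton,
    Matrix.one_mulVec, hinit, ← List.foldl_append]
  exact ⟨hfinal true, hfinal false⟩

/-! ### Testing integers for zero -/

/-- `(x ^ d + x ^ (-d)) / 2`, which is `1` at `d = 0` and at least `x / 2` at other integers. -/
noncomputable def zeroTest (x : ℝ) (d : ℤ) : ℝ := (x ^ d + x ^ (-d)) / 2

section ZeroTest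

variable {x : ℝ}

@[simp] lemma zeroTest_zero : zeroTest x 0 = 1 := by simp [zeroTest]

lemma one_le_zeroTest (hx : 1 ≤ x) (d : ℤ) : 1 ≤ zeroTest x d := by
  have h : 0 < x ^ d := zpow_pos (by linarith) d
  have h1 : x ^ d * x ^ (-d) = 1 := by
    rw [← zpow_add₀ (by linarith)]
    simp
  have h2 : 0 < x ^ (-d) := zpow_pos (by linarith) _
  rw [zeroTest]
  nlinarith [sq_nonneg (x ^ d - x ^ (-d))]

lemma eq_zero_of_zeroTest_lt (hx : 1 ≤ x) (d : ℤ) (h : zeroTest x d < x / 2) : d = 0 := by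
  by_contra hd
  have h1 : 0 < x ^ d := zpow_pos (by linarith) d
  have h2 : 0 < x ^ (-d) := zpow_pos (by linarith) _
  have h3 : x ≤ x ^ d ∨ x ≤ x ^ (-d) := by
    rcases lt_or_gt_of_ne hd with hd | hd
    · right
      simpa using zpow_le_zpow_right₀ hx (show (1 : ℤ) ≤ -d by omega)
    · left
      simpa using zpow_le_zpow_right₀ hx (show (1 : ℤ) ≤ d by omega)
  rw [zeroTest] at h
  rcases h3 with h3 | h3 <;> linarith

end ZeroTest

/-! ### Comparing consecutive blocks -/

/-- Symbols of the verifier: a certificate symbol is a track or the block separator `none`. -/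
abbrev TrackSymbol (k : ℕ) : Type := Option (Fin k) ⊕ Unit

/-- Product of the zero tests of `α (Bᵢ) - β (Bᵢ₊₁)` over consecutive blocks of a word, where `α`
and `β` are additive. Here `d` is the pending difference for the current block and `e` is the
value of `α` on the part of the current block already read. -/
noncomputable def blockTest {k : ℕ} (x : ℝ) (α β : Fin k → ℤ) :
    ℤ → ℤ → List (TrackSymbol k) → ℝ
  | d, _, [] => zeroTest x d
  | d, e, Sum.inl none :: w => zeroTest x d * blockTest x α β e 0 w
  | d, e, Sum.inl (some p) :: w => blockTest x α β (d - β p) (e + α p) w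
  | d, e, Sum.inr () :: w => blockTest x α β d e w

section BlockTest

variable {k : ℕ} {x : ℝ} (α β : Fin k → ℤ)

lemma one_le_blockTest (hx : 1 ≤ x) (w : List (TrackSymbol k)) (d e : ℤ) :
    1 ≤ blockTest x α β d e w := by
  induction w generalizing d e with
  | nil => exact one_le_zeroTest hx d
  | cons s w ih =>
    rcases s with (_ | p) | _
    · exact one_le_mul_of_one_le_of_one_le (one_le_zeroTest hx d) (ih _ _)
    · exact ih _ _
    · exact ih _ _

lemma blockTest_replicate (n : ℕ) (d e : ℤ) :
    blockTest x α β d e (List.replicate n (Sum.inr ())) = zeroTest x d := by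
  induction n with
  | zero => rfl
  | succ n ih => exact ih

lemma blockTest_append (B : List (Fin k)) (w : List (TrackSymbol k)) (d e : ℤ) :
    blockTest x α β d e (B.map (fun p => Sum.inl (some p)) ++ w) =
      blockTest x α β (d - (B.map β).sum) (e + (B.map α).sum) w := by
  induction B generalizing d e with
  | nil => simp
  | cons p B ih =>
    rw [List.map_cons, List.cons_append, blockTest, ih]
    simp only [List.map_cons, List.sum_cons]
    congr 1 <;> ring

/-- The exponent attached to a guessed sign. -/
def signExponent (b : Bool) : ℤ := bif b then 1 else -1

/-- Transition weights of an automaton for `blockTest`. A state consists of a guessed sign for the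
pending difference and a guessed sign for the next difference, or `none` in the last block. -/
noncomputable def blockMatrix (x : ℝ) (α β : Fin k → ℤ) :
    TrackSymbol k → Matrix (Bool × Option Bool) (Bool × Option Bool) ℝ
  | Sum.inl none => Matrix.of fun i j => if j.2 = some i.1 then 1 / 2 else 0
  | Sum.inl (some p) => Matrix.diagonal fun i =>
      x ^ (signExponent i.1 * -β p + i.2.elim 0 signExponent * α p)
  | Sum.inr () => 1

/-- State vector of the automaton for `blockTest`. -/
noncomputable def blockVector (x : ℝ) (d e : ℤ) : Bool × Option Bool → ℝ :=
  fun i => x ^ (signExponent i.1 * d + i.2.elim 0 signExponent * e)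

lemma blockMatrix_separator_mulVec (hx : x ≠ 0) (d e : ℤ) :
    blockMatrix x α β (Sum.inl none) *ᵥ blockVector x d e =
      zeroTest x d • blockVector x e 0 := by
  ext ⟨s, u⟩
  cases s <;>
    simp [blockMatrix, blockVector, Matrix.mulVec, dotProduct, Fintype.sum_prod_type,
      signExponent, zeroTest, zpow_add₀ hx] <;> ring

lemma blockMatrix_track_mulVec (hx : x ≠ 0) (p : Fin k) (d e : ℤ) :
    blockMatrix x α β (Sum.inl (some p)) *ᵥ blockVector x d e =
      blockVector x (d - β p) (e + α p) := by
  ext i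
  rw [blockMatrix, Matrix.mulVec_diagonal, blockVector, blockVector, ← zpow_add₀ hx]
  congr 1
  ring

lemma blockTest_eq_dotProduct (hx : x ≠ 0) (w : List (TrackSymbol k)) (d e : ℤ) (y : ℝ) :
    (fun i : Bool × Option Bool => if i.2 = none then (1 / 2 : ℝ) else 0) ⬝ᵥ
        w.foldl (fun v s => blockMatrix x α β s *ᵥ v) (y • blockVector x d e) =
      y * blockTest x α β d e w := by
  induction w generalizing d e y with
  | nil =>
    simp [dotProduct, blockVector, Fintype.sum_prod_type, signExponent, blockTest, zeroTest]
    ring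
  | cons s w ih =>
    rw [List.foldl_cons, Matrix.mulVec_smul]
    rcases s with (_ | p) | _
    · rw [blockMatrix_separator_mulVec α β hx, smul_smul, ih, blockTest, mul_assoc]
    · rw [blockMatrix_track_mulVec α β hx, ih, blockTest]
    · rw [blockMatrix, Matrix.one_mulVec, ih, blockTest]

lemma nonnegRecognizable_blockTest (hx : 0 < x) (d e : ℤ) :
    NonnegRecognizable (blockTest x α β d e) := by
  refine ⟨Bool × Option Bool, inferInstance, blockVector x d e,
    fun i => if i.2 = none then 1 / 2 else 0, blockMatrix x α β, fun i => (zpow_pos hx _).le,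
    fun i => by dsimp only; split_ifs <;> norm_num, ?_, fun w => ?_⟩
  · rintro ((_ | p) | _) i j
    · simp only [blockMatrix, Matrix.of_apply]
      split_ifs <;> norm_num
    · rw [blockMatrix, Matrix.diagonal_apply]
      split_ifs
      exacts [(zpow_pos hx _).le, le_rfl]
    · rw [blockMatrix, Matrix.one_apply]
      split_ifs <;> norm_num
  · simpa using (blockTest_eq_dotProduct α β hx.ne' w d e 1).symm

end BlockTest

/-! ### Certificates for powers -/

section Power

variable {k : ℕ}

/-- The weight of `j ^ p` in the binomial expansion of `(j + 1) ^ l`. -/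
def binomialWeight (l : ℕ) (p : Fin k) : ℤ := l.choose p

/-- The indicator of the track `l`. -/
def trackWeight (l p : Fin k) : ℤ := if p = l then 1 else 0

/-- The exponent contributed by a symbol to the comparison of the certified power with the input
length. -/
def lengthWeight : TrackSymbol k → ℤ
  | Sum.inl none => 0
  | Sum.inl (some p) => binomialWeight k p
  | Sum.inr () => -1

/-- The test that on track `l` the blocks have counts `0 ^ l, 1 ^ l, 2 ^ l, …`. -/
noncomputable def trackTest (x : ℝ) (l : Fin k) : List (TrackSymbol k) → ℝ :=
  blockTest x (binomialWeight l) (trackWeight l) (0 ^ (l : ℕ)) 0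

lemma sum_pow_mul_binomialWeight (j : ℤ) (l : Fin k) :
    ∑ p : Fin k, j ^ (p : ℕ) * binomialWeight l p = (j + 1) ^ (l : ℕ) := by
  simp only [binomialWeight]
  rw [add_pow, Fin.sum_univ_eq_sum_range (fun p => j ^ p * ((l : ℕ).choose p : ℤ)) k]
  simp only [one_pow, mul_one]
  refine (Finset.sum_subset (Finset.range_subset_range.2 l.2) fun p _ hp => ?_).symm
  rw [Finset.mem_range, not_lt] at hp
  simp [Nat.choose_eq_zero_of_lt hp]

lemma sum_pow_mul_binomialWeight_self (j : ℤ) :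
    ∑ p : Fin k, j ^ (p : ℕ) * binomialWeight k p = (j + 1) ^ k - j ^ k := by
  simp only [binomialWeight]
  rw [add_pow, Fin.sum_univ_eq_sum_range (fun p => j ^ p * (k.choose p : ℤ)) k,
    Finset.sum_range_succ]
  simp

lemma sum_mul_trackWeight (q : Fin k → ℤ) (l : Fin k) :
    ∑ p, q p * trackWeight l p = q l := by
  simp [trackWeight]

lemma sum_lengthWeight_replicate (n : ℕ) :
    ((List.replicate n (Sum.inr () : TrackSymbol k)).map lengthWeight).sum = -n := by
  simp [lengthWeight]

/-- A word passing all track tests from block `j` on certifies a `k`-th power; `q` holds the counts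
in the part of block `j` already read. -/
lemma exists_pow_of_blockTest_lt {x : ℝ} (hx : 1 ≤ x) (n : ℕ) (c : List (Option (Fin k)))
    (j : ℕ) (q : Fin k → ℤ)
    (h : ∀ l : Fin k, blockTest x (binomialWeight l) (trackWeight l) ((j : ℤ) ^ (l : ℕ) - q l)
      (∑ p, q p * binomialWeight l p) (c.map Sum.inl ++ List.replicate n (Sum.inr ())) < x / 2) :
    ∃ i : ℕ, (j : ℤ) ^ k + ∑ p, q p * binomialWeight k p +
      ((c.map Sum.inl ++ List.replicate n (Sum.inr ())).map lengthWeight).sum + n =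
        (i : ℤ) ^ k := by
  induction c generalizing j q with
  | nil =>
    have hq : ∀ l, q l = (j : ℤ) ^ (l : ℕ) := fun l => by
      have := h l
      rw [List.map_nil, List.nil_append, blockTest_replicate] at this
      linarith [eq_zero_of_zeroTest_lt hx _ this]
    refine ⟨j + 1, ?_⟩
    rw [List.map_nil, List.nil_append, sum_lengthWeight_replicate]
    simp only [hq, sum_pow_mul_binomialWeight_self]
    push_cast
    ring
  | cons s c ih =>
    rcases s with _ | p
    · have hq : ∀ l, q l = (j : ℤ) ^ (l : ℕ) := fun l => by
        have := h l
        rw [List.map_cons, List.cons_append, blockTest] at this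
        have h0 := one_le_zeroTest hx ((j : ℤ) ^ (l : ℕ) - q l)
        have h1 := eq_zero_of_zeroTest_lt hx _ (lt_of_le_of_lt
          (le_mul_of_one_le_right (by linarith) (one_le_blockTest _ _ hx _ _ _)) this)
        linarith
      obtain ⟨i, hi⟩ := ih (j + 1) 0 fun l => by
        have := h l
        rw [List.map_cons, List.cons_append, blockTest, hq, sub_self, zeroTest_zero, one_mul]
          at this
        simp only [hq, sum_pow_mul_binomialWeight] at this
        simpa using this
      refine ⟨i, ?_⟩
      rw [← hi]
      simp only [hq, sum_pow_mul_binomialWeight_self]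
      simp [lengthWeight]
    · have hsum : ∀ f : Fin k → ℤ,
          ∑ r, (q + Pi.single p 1 : Fin k → ℤ) r * f r = ∑ r, q r * f r + f p := fun f => by
        simp [add_mul, Finset.sum_add_distrib, Pi.single_apply]
      obtain ⟨i, hi⟩ := ih j (q + Pi.single p 1) fun l => by
        have := h l
        rw [List.map_cons, List.cons_append, blockTest] at this
        rw [hsum]
        convert this using 2
        simp [trackWeight, Pi.single_apply, eq_comm (a := p), sub_sub]
      refine ⟨i, ?_⟩
      rw [← hi, hsum]
      simp only [List.map_cons, List.cons_append, List.sum_cons, lengthWeight]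
      ring

lemma exists_list_sum_map (q : Fin k → ℕ) :
    ∃ B : List (Fin k), ∀ f : Fin k → ℤ, (B.map f).sum = ∑ p, q p * f p := by
  refine ⟨(List.finRange k).flatMap fun p => List.replicate (q p) p, fun f => ?_⟩
  rw [List.map_flatMap, List.flatMap_def, List.sum_flatten]
  simp [Fin.sum_univ_def, Function.comp_def]

lemma exists_block (j : ℕ) :
    ∃ B : List (Fin k), (∀ f : Fin k → ℤ, (B.map f).sum = ∑ p : Fin k, (j : ℤ) ^ (p : ℕ) * f p) ∧
      (B.length : ℤ) ≤ ((j : ℤ) + 1) ^ k - (j : ℤ) ^ k := by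
  obtain ⟨B, hB⟩ := exists_list_sum_map (k := k) fun p => j ^ (p : ℕ)
  push_cast at hB
  refine ⟨B, hB, ?_⟩
  have hlen : (B.length : ℤ) = ∑ p : Fin k, (j : ℤ) ^ (p : ℕ) * 1 := by
    rw [← hB]
    simp
  rw [hlen, ← sum_pow_mul_binomialWeight_self]
  refine Finset.sum_le_sum fun p _ => mul_le_mul_of_nonneg_left ?_ (by positivity)
  have := Nat.choose_pos p.2.le
  rw [binomialWeight]
  omega

/-- The blocks `j, …, j + r` of the certificate. -/
lemma exists_certificate (x : ℝ) (n r j : ℕ) :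
    ∃ c : List (Option (Fin k)),
      (c.length : ℤ) ≤ r + (((j : ℤ) + r + 1) ^ k - (j : ℤ) ^ k) ∧
      (∀ l : Fin k, blockTest x (binomialWeight l) (trackWeight l) ((j : ℤ) ^ (l : ℕ)) 0
        (c.map Sum.inl ++ List.replicate n (Sum.inr ())) = 1) ∧
      ((c.map Sum.inl ++ List.replicate n (Sum.inr ())).map lengthWeight).sum =
        ((j : ℤ) + r + 1) ^ k - (j : ℤ) ^ k - n := by
  induction r generalizing j with
  | zero =>
    obtain ⟨B, hB, hlen⟩ := exists_block (k := k) j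
    refine ⟨B.map some, by simpa using hlen, fun l => ?_, ?_⟩
    · rw [List.map_map, Function.comp_def, blockTest_append, blockTest_replicate, hB,
        sum_mul_trackWeight (fun p => (j : ℤ) ^ (p : ℕ)), sub_self, zeroTest_zero]
    · rw [List.map_append, List.sum_append, sum_lengthWeight_replicate, List.map_map, List.map_map]
      have := hB (binomialWeight k)
      rw [sum_pow_mul_binomialWeight_self] at this
      simpa [Function.comp_def, lengthWeight, sub_eq_add_neg] using this
  | succ r ih =>
    obtain ⟨B, hB, hlen⟩ := exists_block (k := k) j
    obtain ⟨c, hc, htest, hsum⟩ := ih (j + 1)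
    push_cast at hc htest hsum
    refine ⟨B.map some ++ none :: c, ?_, fun l => ?_, ?_⟩
    · simp only [List.length_append, List.length_map, List.length_cons]
      push_cast
      rw [show (j : ℤ) + (r + 1) + 1 = j + 1 + r + 1 by ring]
      linarith
    · rw [List.map_append, List.map_map, Function.comp_def, List.append_assoc, blockTest_append,
        hB, hB, sum_mul_trackWeight (fun p => (j : ℤ) ^ (p : ℕ)), sum_pow_mul_binomialWeight,
        List.map_cons, List.cons_append, blockTest, sub_self, zeroTest_zero, one_mul, zero_add,
        htest]
    · have := hB (binomialWeight k)
      rw [sum_pow_mul_binomialWeight_self] at this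
      rw [List.map_append (f := Sum.inl), List.append_assoc, List.map_append, List.sum_append,
        List.map_cons, List.cons_append, List.map_cons, List.sum_cons, hsum, List.map_map,
        List.map_map, show (lengthWeight ∘ Sum.inl) ∘ some = binomialWeight k from rfl, this,
        lengthWeight]
      push_cast
      ring

/-- Accepting weight of the verifier: `1`, and `1 + x` on the empty input. -/
noncomputable def powerAccept (x : ℝ) (w : List (TrackSymbol k)) : ℝ :=
  1 + x * (w.map (Sum.elim (fun _ => 1) fun _ => 0)).prod

/-- Rejecting weight of the verifier. -/
noncomputable def powerReject (x : ℝ) (w : List (TrackSymbol k)) : ℝ :=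
  (3 * (k + 1) : ℝ)⁻¹ * (∑ l : Fin k, trackTest x l w + zeroTest x (w.map lengthWeight).sum)

lemma nonnegRecognizable_powerAccept {x : ℝ} (hx : 0 ≤ x) :
    NonnegRecognizable (powerAccept (k := k) x) := by
  refine (NonnegRecognizable.const zero_le_one).add
    ((NonnegRecognizable.prod_map ?_).const_mul hx)
  rintro (_ | _) <;> simp

lemma nonnegRecognizable_zpow_sum {S : Type} {x : ℝ} (hx : 0 < x) (g : S → ℤ) :
    NonnegRecognizable (fun w => x ^ (w.map g).sum) := by
  convert NonnegRecognizable.prod_map (g := fun s => x ^ g s) (fun s => (zpow_pos hx _).le)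
    using 2 with w
  induction w with
  | nil => simp
  | cons s w ih => simp [zpow_add₀ hx.ne', ih]

lemma nonnegRecognizable_powerReject {x : ℝ} (hx : 0 < x) :
    NonnegRecognizable (powerReject (k := k) x) := by
  have h : NonnegRecognizable fun w : List (TrackSymbol k) =>
      zeroTest x (w.map lengthWeight).sum := by
    convert ((nonnegRecognizable_zpow_sum hx lengthWeight).add
      (nonnegRecognizable_zpow_sum hx fun s : TrackSymbol k => -lengthWeight s)).const_mul
      (show (0 : ℝ) ≤ 1 / 2 by norm_num) using 2 with w
    have : (w.map fun s => -lengthWeight s).sum = -(w.map lengthWeight).sum := by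
      induction w with
      | nil => simp
      | cons s w ih => simp [ih]; ring
    rw [zeroTest, this]
    ring
  exact ((NonnegRecognizable.sum _ fun l _ =>
    nonnegRecognizable_blockTest _ _ hx _ _).add h).const_mul (by positivity)

lemma powerReject_pos {x : ℝ} (hx : 1 ≤ x) (w : List (TrackSymbol k)) : 0 < powerReject x w := by
  have h1 : ∀ l : Fin k, 0 ≤ trackTest x l w := fun l =>
    zero_le_one.trans (one_le_blockTest _ _ hx _ _ _)
  have h2 := one_le_zeroTest hx (w.map lengthWeight).sum
  have h3 := Finset.sum_nonneg fun l (_ : l ∈ Finset.univ) => h1 l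
  have : (0 : ℝ) < (3 * (k + 1) : ℝ)⁻¹ := by positivity
  exact mul_pos this (by linarith)

lemma one_le_powerAccept {x : ℝ} (hx : 0 ≤ x) (w : List (TrackSymbol k)) :
    1 ≤ powerAccept x w := by
  have : 0 ≤ (w.map (Sum.elim (fun _ => 1) fun _ => 0 : TrackSymbol k → ℝ)).prod := by
    refine List.prod_nonneg fun a ha => ?_
    obtain ⟨s, -, rfl⟩ := List.mem_map.1 ha
    rcases s with _ | _ <;> simp
  rw [powerAccept]
  nlinarith

lemma powerAccept_eq_one (x : ℝ) (c : List (Option (Fin k))) {n : ℕ} (hn : n ≠ 0) :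
    powerAccept x (c.map Sum.inl ++ List.replicate n (Sum.inr ())) = 1 := by
  simp [powerAccept, hn]

lemma exists_powerReject_le {x : ℝ} (hx : 1 ≤ x) (hk : 2 ≤ k) (i : ℕ) :
    ∃ c : List (Option (Fin k)), c.length ≤ 2 * (i ^ k + 1) ∧
      3 * powerReject x (c.map Sum.inl ++ List.replicate (i ^ k) (Sum.inr ())) ≤
        powerAccept x (c.map Sum.inl ++ List.replicate (i ^ k) (Sum.inr ())) := by
  rcases i with _ | i
  · refine ⟨[], by simp, ?_⟩
    have h : ∀ l : Fin k, trackTest x l [] ≤ x := fun l => by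
      rw [trackTest, blockTest]
      rcases Nat.eq_zero_or_pos (l : ℕ) with hl | hl
      · rw [hl, zeroTest]
        have := inv_le_one_of_one_le₀ hx
        simp
        linarith
      · rw [zero_pow hl.ne', zeroTest_zero]
        exact hx
    have h' := Finset.sum_le_sum fun l (_ : l ∈ Finset.univ) => h l
    simp only [Finset.sum_const, Finset.card_univ, Fintype.card_fin, nsmul_eq_mul] at h'
    rw [zero_pow (by omega)]
    simp only [powerReject, powerAccept, List.map_nil, List.replicate_zero, List.append_nil,
      List.sum_nil, List.prod_nil, zeroTest_zero]
    rw [mul_inv, ← mul_assoc, ← mul_assoc]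
    norm_num
    rw [inv_mul_le_iff₀ (by positivity)]
    nlinarith
  · obtain ⟨c, hc, htest, hsum⟩ := exists_certificate (k := k) x ((i + 1) ^ k) i 0
    have h0 : (0 : ℤ) ^ k = 0 := zero_pow (by omega)
    push_cast at hc htest hsum
    rw [h0, zero_add] at hc hsum
    refine ⟨c, ?_, ?_⟩
    · have h1 : i + 1 ≤ (i + 1) ^ k := Nat.le_self_pow (by omega) _
      zify at h1 ⊢
      linarith
    · refine le_trans (le_of_eq ?_) (one_le_powerAccept (by linarith) _)
      rw [powerReject, hsum]
      simp only [trackTest, htest]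
      simp
      field_simp

lemma three_mul_powerAccept_le {x : ℝ} (hx : 1 ≤ x) (hxk : 18 * (k + 1) ≤ x) (hk : 2 ≤ k) {n : ℕ}
    (hn : ¬ ∃ i : ℕ, n = i ^ k) (c : List (Option (Fin k))) :
    3 * powerAccept x (c.map Sum.inl ++ List.replicate n (Sum.inr ())) ≤
      powerReject x (c.map Sum.inl ++ List.replicate n (Sum.inr ())) := by
  have hn0 : n ≠ 0 := by
    rintro rfl
    exact hn ⟨0, (zero_pow (by omega)).symm⟩
  rw [powerAccept_eq_one x c hn0, powerReject]
  set w : List (TrackSymbol k) := c.map Sum.inl ++ List.replicate n (Sum.inr ()) with hw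
  have h1 : ∀ l : Fin k, 0 ≤ trackTest x l w := fun l =>
    zero_le_one.trans (one_le_blockTest _ _ hx _ _ _)
  have h2 := one_le_zeroTest hx (w.map lengthWeight).sum
  suffices h : x / 2 ≤
      ∑ l : Fin k, trackTest x l w + zeroTest x (w.map lengthWeight).sum by
    rw [le_inv_mul_iff₀ (by positivity)]
    linarith
  by_contra! hlt
  have h3 := Finset.sum_nonneg fun l (_ : l ∈ Finset.univ) => h1 l
  have hlen : (w.map lengthWeight).sum = 0 := eq_zero_of_zeroTest_lt hx _ (by linarith)
  obtain ⟨i, hi⟩ := exists_pow_of_blockTest_lt hx n c 0 0 fun l => by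
    have h4 := Finset.single_le_sum (fun l _ => h1 l) (Finset.mem_univ l)
    have h5 : trackTest x l w < x / 2 := by linarith
    simpa [trackTest] using h5
  rw [← hw, hlen] at hi
  refine hn ⟨i, ?_⟩
  have h0 : (0 : ℤ) ^ k = 0 := zero_pow (by omega)
  simp only [Nat.cast_zero, h0, Pi.zero_apply, zero_mul, Finset.sum_const_zero, zero_add] at hi
  exact_mod_cast hi

end Power

lemma three_quarters_le_div {s t : ℝ} (ht : 0 < t) (h : 3 * t ≤ s) {a : ℝ} (ha : 0 < a) :
    1 - 1 / 4 ≤ a * s / (a * s + a * t) := by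
  rw [← mul_add, mul_div_mul_left _ _ ha.ne', le_div_iff₀ (by linarith)]
  linarith

/-- for every `k ≥ 2` there is an MA-PostPFA with some finite certificate
alphabet `Γ` and input alphabet `{a}` verifying `UPOLY(k)` with bounded error using
linear-size certificates: members `a^(i^k)` have an accepting certificate of length at most
`C·(i^k + 1)`. -/
theorem mapostpfa_upoly (k : ℕ) (hk : 2 ≤ k) :
    ∃ (ε : ℝ) (C : ℕ) (Γ : Type) (_ : Fintype Γ) (M : MAPostPFA (Γ ⊕ Unit)),
      ε < 1 / 2 ∧
      (∀ (c : List Γ) (n : ℕ),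
        0 < M.aPr (c.map Sum.inl) (List.replicate n (Sum.inr ())) +
            M.rPr (c.map Sum.inl) (List.replicate n (Sum.inr ()))) ∧
      (∀ i : ℕ, ∃ c : List Γ, c.length ≤ C * (i ^ k + 1) ∧
        1 - ε ≤ M.accProb (c.map Sum.inl) (List.replicate (i ^ k) (Sum.inr ()))) ∧
      (∀ n : ℕ, (¬ ∃ i : ℕ, n = i ^ k) → ∀ c : List Γ,
        1 - ε ≤ M.rejProb (c.map Sum.inl) (List.replicate n (Sum.inr ()))) := by
  have hx : (1 : ℝ) ≤ 18 * (k + 1) := by linarith [(Nat.cast_nonneg k : (0 : ℝ) ≤ k)]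
  have hx0 : (0 : ℝ) < 18 * (k + 1) := by linarith
  obtain ⟨M, hM⟩ := exists_mapostpfa (nonnegRecognizable_powerAccept (k := k) hx0.le)
    (nonnegRecognizable_powerReject hx0)
  refine ⟨1 / 4, 2, Option (Fin k), inferInstance, M, by norm_num, fun c n => ?_, fun i => ?_,
    fun n hn c => ?_⟩
  · obtain ⟨a, ha, h1, h2⟩ := hM (c.map Sum.inl) (List.replicate n (Sum.inr ()))
    rw [h1, h2, ← mul_add]
    exact mul_pos ha (add_pos (zero_lt_one.trans_le (one_le_powerAccept hx0.le _))
      (powerReject_pos hx _))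
  · obtain ⟨c, hc, h⟩ := exists_powerReject_le hx hk i
    refine ⟨c, hc, ?_⟩
    obtain ⟨a, ha, h1, h2⟩ := hM (c.map Sum.inl) (List.replicate (i ^ k) (Sum.inr ()))
    rw [MAPostPFA.accProb, h1, h2]
    exact three_quarters_le_div (powerReject_pos hx _) h ha
  · obtain ⟨a, ha, h1, h2⟩ := hM (c.map Sum.inl) (List.replicate n (Sum.inr ()))
    rw [MAPostPFA.rejProb, h1, h2, add_comm (a * powerAccept _ _)]
    exact three_quarters_le_div (zero_lt_one.trans_le (one_le_powerAccept hx0.le _))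
      (three_mul_powerAccept_le hx le_rfl hk hn c) ha
end

section
/- There exist ε < 1/2 and an MA-PostPFA M with certificate alphabet {a,b} and input alphabet {a} such that: a(c,x)+r(c,x) > 0 for all certificates and inputs; for every i ≥ 1, on input a^(2^i) the certificate a^(2^0) b a^(2^1) b ⋯ b a^(2^(i−1)) (of length 2^i − 1 + (i−1) ≤ 2·2^i) gives acceptance probability at least 1−ε, and on input a^(2^0)=a some certificate of length at most 2 gives acceptance probability at least 1−ε; and for every n that is not a power of 2 and every certificate c ∈ {a,b}*, the rejection probability is at least 1−ε. Hence M verifies UPOWER = { a^(2^i) : i ≥ 0 } with bounded error using linear-size binary certificates. -/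
open Matrix

namespace UPower

/-- The distribution on the nine states after the left certificate marker. State `0` is a sink,
`1` and `8` carry the accepting weight while the certificate, respectively the input, is read,
`2`, …, `5` carry the rejecting weight, and `6`, `7` recognise the input `a` under the empty
certificate. -/
noncomputable def start : Fin 9 → ℝ :=
  ![703 / 2048, 1 / 32, 1 / 4096, 1 / 4096, 1 / 16, 1 / 16, 1 / 2, 0, 0]

/-- The transition matrix of the left certificate marker. -/
noncomputable def openMat : Matrix (Fin 9) (Fin 9) ℝ := Matrix.of fun i _ => start i

/-- The transition matrix of the symbol `a`; row `j` of the transpose is the image of state `j`. -/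
noncomputable def aMat : Matrix (Fin 9) (Fin 9) ℝ :=
  !![1, 0, 0, 0, 0, 0, 0, 0, 0;
     1 - (1 / 16) ^ 3, (1 / 16) ^ 3, 0, 0, 0, 0, 0, 0, 0;
     1 - (1 / 16) ^ 4, 0, (1 / 16) ^ 4, 0, 0, 0, 0, 0, 0;
     0, 0, 0, 1, 0, 0, 0, 0, 0;
     1 - (1 / 16) ^ 6, 0, 0, 0, (1 / 16) ^ 6, 0, 0, 0, 0;
     1 - (1 / 16) ^ 2, 0, 0, 0, 0, (1 / 16) ^ 2, 0, 0, 0;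
     0, 0, 0, 0, 0, 0, 0, 1, 0;
     1, 0, 0, 0, 0, 0, 0, 0, 0;
     1 - 1 / 16, 0, 0, 0, 0, 0, 0, 0, 1 / 16]ᵀ

/-- The transition matrix of the symbol `b`. -/
noncomputable def bMat : Matrix (Fin 9) (Fin 9) ℝ :=
  !![1, 0, 0, 0, 0, 0, 0, 0, 0;
     0, 1, 0, 0, 0, 0, 0, 0, 0;
     0, 0, 1 / 2, 1 / 2, 0, 0, 0, 0, 0;
     0, 0, 0, 0, 1 / 2, 1 / 2, 0, 0, 0;
     0, 0, 1 / 2, 1 / 2, 0, 0, 0, 0, 0;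
     0, 0, 0, 0, 1 / 2, 1 / 2, 0, 0, 0;
     1, 0, 0, 0, 0, 0, 0, 0, 0;
     1, 0, 0, 0, 0, 0, 0, 0, 0;
     1, 0, 0, 0, 0, 0, 0, 0, 0]ᵀ

/-- The transition matrix of the right certificate marker. -/
noncomputable def closeMat : Matrix (Fin 9) (Fin 9) ℝ :=
  !![1, 0, 0, 0, 0, 0, 0, 0, 0;
     0, 0, 0, 0, 0, 0, 0, 0, 1;
     0, 0, 0, 1, 0, 0, 0, 0, 0;
     0, 0, 0, 0, 0, 1, 0, 0, 0;
     0, 0, 0, 1, 0, 0, 0, 0, 0;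
     0, 0, 0, 0, 0, 1, 0, 0, 0;
     0, 0, 0, 0, 0, 0, 1, 0, 0;
     1, 0, 0, 0, 0, 0, 0, 0, 0;
     1, 0, 0, 0, 0, 0, 0, 0, 0]ᵀ

lemma colStochastic_openMat : ColStochastic openMat := by
  constructor
  · intro i j
    fin_cases i <;> norm_num [openMat, start]
  · intro j
    simp only [openMat, start, Matrix.of_apply, Fin.sum_univ_succ]
    norm_num [Fin.succ]

lemma colStochastic_aMat : ColStochastic aMat := by
  constructor
  · intro i j
    fin_cases j <;> fin_cases i <;> norm_num [aMat]
  · intro j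
    fin_cases j <;> norm_num [aMat, Fin.sum_univ_succ]

lemma colStochastic_bMat : ColStochastic bMat := by
  constructor
  · intro i j
    fin_cases j <;> fin_cases i <;> norm_num [bMat]
  · intro j
    fin_cases j <;> norm_num [bMat, Fin.sum_univ_succ]

lemma colStochastic_closeMat : ColStochastic closeMat := by
  constructor
  · intro i j
    fin_cases j <;> fin_cases i <;> norm_num [closeMat]
  · intro j
    fin_cases j <;> norm_num [closeMat, Fin.sum_univ_succ]

lemma colStochastic_one {m : ℕ} : ColStochastic (1 : Matrix (Fin m) (Fin m) ℝ) := by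
  refine ⟨fun i j => ?_, fun j => by simp [Matrix.one_apply]⟩
  rw [Matrix.one_apply]
  split_ifs <;> norm_num

/-- The verifier for `UPOWER`. -/
noncomputable def verifier : MAPostPFA Bool where
  m := 9
  Aopen := openMat
  Aclose := closeMat
  Acent := 1
  Adollar := 1
  Asym s := if s then bMat else aMat
  hopen := colStochastic_openMat
  hclose := colStochastic_closeMat
  hcent := colStochastic_one
  hdollar := colStochastic_one
  hsym s := by
    cases s
    · simpa using colStochastic_aMat
    · simpa using colStochastic_bMat
  Facc := {7, 8}
  Frej := {3, 5}
  disj := by decide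

/-- One step of the verifier on a certificate or input symbol. -/
noncomputable def step (v : Fin 9 → ℝ) (s : Bool) : Fin 9 → ℝ :=
  (if s then bMat else aMat).mulVec v

/-- The state vector while the certificate is read: `l` is the length of the current block, `u` is
the length it should have, and `P`, `Q` are the rejecting and accepting weights of the comparisons
completed so far. -/
structure CertState (P Q : ℝ) (u l : ℕ) (v : Fin 9 → ℝ) : Prop where
  acc : v 1 = 4 * (Q * (1 / 16) ^ (u + l)) * (1 / 16) ^ (2 * l)
  left_left : v 2 = P / 2 * (1 / 16) ^ (2 * u) * (1 / 16) ^ (4 * l)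
  left_right : v 3 = P / 2 * (1 / 16) ^ (2 * u)
  right_left : v 4 = P / 2 * (1 / 16) ^ (2 * l) * (1 / 16) ^ (4 * l)
  right_right : v 5 = P / 2 * (1 / 16) ^ (2 * l)
  extra : 0 ≤ v 6

/-- The rejecting weight after comparing `u` with `l`. -/
noncomputable def nextRej (P : ℝ) (u l : ℕ) : ℝ :=
  P * ((1 / 16) ^ (2 * u) + (1 / 16) ^ (2 * l)) / 2

/-- The accepting weight after comparing `u` with `l`. -/
noncomputable def nextAcc (Q : ℝ) (u l : ℕ) : ℝ := Q * (1 / 16) ^ (u + l)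

/-- Either all comparisons so far succeeded, the weights agree and the next expected length is a
power of two, or the rejecting weight dominates. -/
def Sound (P Q : ℝ) (u : ℕ) : Prop :=
  0 < Q ∧ ((P = Q ∧ ∃ j : ℕ, u = 2 ^ j) ∨ 8 * Q ≤ P)

lemma pow_add_le_half_sum (u l : ℕ) :
    (1 / 16 : ℝ) ^ (u + l) ≤ ((1 / 16) ^ (2 * u) + (1 / 16) ^ (2 * l)) / 2 := by
  rw [pow_add, mul_comm 2 u, mul_comm 2 l, pow_mul, pow_mul]
  nlinarith [sq_nonneg ((1 / 16 : ℝ) ^ u - (1 / 16) ^ l)]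

lemma eight_mul_pow_add_le_of_lt {u l : ℕ} (h : u < l) :
    8 * (1 / 16 : ℝ) ^ (u + l) ≤ ((1 / 16) ^ (2 * u) + (1 / 16) ^ (2 * l)) / 2 := by
  have h1 : (1 / 16 : ℝ) ^ (u + l) ≤ (1 / 16) ^ (2 * u + 1) :=
    pow_le_pow_of_le_one (by norm_num) (by norm_num) (by omega)
  have h2 : (0 : ℝ) < (1 / 16) ^ (2 * l) := by positivity
  rw [pow_succ] at h1
  linarith

lemma eight_mul_pow_add_le {u l : ℕ} (h : u ≠ l) :
    8 * (1 / 16 : ℝ) ^ (u + l) ≤ ((1 / 16) ^ (2 * u) + (1 / 16) ^ (2 * l)) / 2 := by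
  rcases lt_or_gt_of_ne h with h | h
  · exact eight_mul_pow_add_le_of_lt h
  · have := eight_mul_pow_add_le_of_lt h
    rwa [add_comm l u, add_comm ((1 / 16 : ℝ) ^ (2 * l))] at this

lemma nextRej_self (P : ℝ) (u : ℕ) : nextRej P u u = nextAcc P u u := by
  rw [nextRej, nextAcc, ← two_mul u]
  ring

lemma Sound.next {P Q : ℝ} {u : ℕ} (h : Sound P Q u) (l : ℕ) :
    Sound (nextRej P u l) (nextAcc Q u l) (2 * l) := by
  obtain ⟨hQ, h⟩ := h
  have hx : (0 : ℝ) < (1 / 16) ^ (u + l) := by positivity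
  refine ⟨mul_pos hQ hx, ?_⟩
  rcases h with ⟨rfl, j, hj⟩ | h
  · by_cases hul : u = l
    · subst hul
      exact Or.inl ⟨nextRej_self P u, j + 1, by rw [hj, pow_succ, mul_comm]⟩
    · right
      have := mul_le_mul_of_nonneg_left (eight_mul_pow_add_le hul) hQ.le
      unfold nextRej nextAcc
      linarith
  · right
    have := mul_le_mul h (pow_add_le_half_sum u l) hx.le (by linarith)
    unfold nextRej nextAcc
    linarith

lemma CertState.step_a {P Q : ℝ} {u l : ℕ} {v : Fin 9 → ℝ} (h : CertState P Q u l v) :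
    CertState P Q u (l + 1) (step v false) := by
  obtain ⟨h1, h2, h3, h4, h5, -⟩ := h
  constructor <;>
    simp [step, aMat, Matrix.mulVec, dotProduct, Fin.sum_univ_succ, *] <;> ring

lemma CertState.step_b {P Q : ℝ} {u l : ℕ} {v : Fin 9 → ℝ} (h : CertState P Q u l v) :
    CertState (nextRej P u l) (nextAcc Q u l) (2 * l) 0 (step v true) := by
  obtain ⟨h1, h2, h3, h4, h5, -⟩ := h
  constructor <;>
    simp [step, bMat, Matrix.mulVec, dotProduct, Fin.sum_univ_succ, nextRej, nextAcc, *] <;> ring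

lemma CertState.foldl_replicate {P Q : ℝ} {u l : ℕ} {v : Fin 9 → ℝ} (h : CertState P Q u l v)
    (n : ℕ) : CertState P Q u (l + n) ((List.replicate n false).foldl step v) := by
  induction n generalizing l v with
  | zero => exact h
  | succ n ih =>
    rw [List.replicate_succ, List.foldl_cons, add_comm n 1, ← add_assoc]
    exact ih h.step_a

lemma openMat_mulVec_e1 : openMat.mulVec (e1 9) = start := by
  ext i
  simp [openMat, Matrix.mulVec, dotProduct, e1]

lemma certState_start : CertState (1 / 8) (1 / 8) 1 0 start := by
  constructor <;> simp [start] <;> norm_num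

lemma exists_certState (c : List Bool) :
    ∃ P Q u l, Sound P Q u ∧ CertState P Q u l (c.foldl step start) := by
  induction c using List.reverseRecOn with
  | nil => exact ⟨_, _, _, _, ⟨by norm_num, Or.inl ⟨rfl, 0, rfl⟩⟩, certState_start⟩
  | append_singleton c s ih =>
    obtain ⟨P, Q, u, l, hs, hc⟩ := ih
    rw [List.foldl_append, List.foldl_cons, List.foldl_nil]
    cases s
    · exact ⟨_, _, _, _, hs, hc.step_a⟩
    · exact ⟨_, _, _, _, hs.next l, hc.step_b⟩

lemma intercalate_append_singleton {α : Type*} (s x : List α) {L : List (List α)} (hL : L ≠ []) :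
    s.intercalate (L ++ [x]) = s.intercalate L ++ s ++ x := by
  induction L with
  | nil => exact absurd rfl hL
  | cons y L ih =>
    rcases eq_or_ne L [] with rfl | h
    · simp [List.intercalate_cons_cons]
    · rw [List.cons_append, List.intercalate_cons_of_ne_nil (by simp),
        List.intercalate_cons_of_ne_nil h, ih h]
      simp

/-- The certificate `a^(2^0) b a^(2^1) b ⋯ b a^(2^(i-1))`. -/
def honestCert (i : ℕ) : List Bool :=
  List.intercalate [true] ((List.range i).map fun j => List.replicate (2 ^ j) false)

lemma honestCert_succ {i : ℕ} (hi : i ≠ 0) :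
    honestCert (i + 1) = honestCert i ++ [true] ++ List.replicate (2 ^ i) false := by
  rw [honestCert, List.range_succ, List.map_append, List.map_singleton,
    intercalate_append_singleton _ _ (by simpa using hi), honestCert]

lemma certState_honestCert (i : ℕ) :
    ∃ P, 0 < P ∧ CertState P P (2 ^ i) (2 ^ i) ((honestCert (i + 1)).foldl step start) := by
  induction i with
  | zero =>
    refine ⟨1 / 8, by norm_num, ?_⟩
    simpa [honestCert] using certState_start.step_a
  | succ i ih =>
    obtain ⟨P, hP, hc⟩ := ih
    refine ⟨nextAcc P (2 ^ i) (2 ^ i), mul_pos hP (by positivity), ?_⟩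
    rw [honestCert_succ i.succ_ne_zero, List.foldl_append, List.foldl_append]
    have := hc.step_b.foldl_replicate (2 ^ (i + 1))
    rwa [nextRej_self, zero_add, ← pow_succ'] at this

/-- The state vector after reading `n` input symbols, where `u` is the expected input length and
`t` the weight of the branch that recognises the input `a`. -/
structure InputState (P Q : ℝ) (u : ℕ) (t : ℝ) (n : ℕ) (v : Fin 9 → ℝ) : Prop where
  rej_left : v 3 = P * (1 / 16) ^ (2 * u)
  rej_right : v 5 = P * (1 / 16) ^ (2 * n)
  acc : v 8 = 4 * (Q * (1 / 16) ^ (u + n))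
  extra_zero : v 6 = if n = 0 then t else 0
  extra_one : v 7 = if n = 1 then t else 0

lemma CertState.close {P Q : ℝ} {u l : ℕ} {v : Fin 9 → ℝ} (h : CertState P Q u l v) :
    InputState (nextRej P u l) (nextAcc Q u l) (2 * l) (v 6) 0 (closeMat.mulVec v) := by
  obtain ⟨h1, h2, h3, h4, h5, -⟩ := h
  constructor <;>
    simp [closeMat, Matrix.mulVec, dotProduct, Fin.sum_univ_succ, nextRej, nextAcc, *] <;> ring

lemma InputState.step_a {P Q : ℝ} {u : ℕ} {t : ℝ} {n : ℕ} {v : Fin 9 → ℝ}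
    (h : InputState P Q u t n v) : InputState P Q u t (n + 1) (step v false) := by
  obtain ⟨h3, h5, h8, h6, h7⟩ := h
  constructor <;>
    simp [step, aMat, Matrix.mulVec, dotProduct, Fin.sum_univ_succ, *] <;> ring

lemma InputState.foldl_replicate {P Q : ℝ} {u : ℕ} {t : ℝ} {v : Fin 9 → ℝ}
    (h : InputState P Q u t 0 v) (n : ℕ) :
    InputState P Q u t n ((List.replicate n false).foldl step v) := by
  induction n with
  | zero => exact h
  | succ n ih =>
    rw [List.replicate_succ', List.foldl_append]
    exact ih.step_a

/-- The final state vector of the verifier. -/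
noncomputable def run (c x : List Bool) : Fin 9 → ℝ :=
  x.foldl step (closeMat.mulVec (c.foldl step start))

lemma verifier_aPr (c x : List Bool) : verifier.aPr c x = run c x 7 + run c x 8 := by
  change ∑ j ∈ ({7, 8} : Finset (Fin 9)), (1 : Matrix (Fin 9) (Fin 9) ℝ).mulVec (x.foldl step
    ((1 : Matrix (Fin 9) (Fin 9) ℝ).mulVec
      (closeMat.mulVec (c.foldl step (openMat.mulVec (e1 9)))))) j = _
  rw [Matrix.one_mulVec, Matrix.one_mulVec, openMat_mulVec_e1, Finset.sum_pair (by decide), run]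

lemma verifier_rPr (c x : List Bool) : verifier.rPr c x = run c x 3 + run c x 5 := by
  change ∑ j ∈ ({3, 5} : Finset (Fin 9)), (1 : Matrix (Fin 9) (Fin 9) ℝ).mulVec (x.foldl step
    ((1 : Matrix (Fin 9) (Fin 9) ℝ).mulVec
      (closeMat.mulVec (c.foldl step (openMat.mulVec (e1 9)))))) j = _
  rw [Matrix.one_mulVec, Matrix.one_mulVec, openMat_mulVec_e1, Finset.sum_pair (by decide), run]

lemma CertState.weights {c : List Bool} {P Q : ℝ} {u l : ℕ}
    (h : CertState P Q u l (c.foldl step start)) (n : ℕ) :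
    verifier.aPr c (List.replicate n false) =
        (if n = 1 then c.foldl step start 6 else 0) +
          4 * nextAcc (nextAcc Q u l) (2 * l) n ∧
      verifier.rPr c (List.replicate n false) = 2 * nextRej (nextRej P u l) (2 * l) n := by
  have hv : InputState _ _ _ _ n (run c (List.replicate n false)) := h.close.foldl_replicate n
  constructor
  · rw [verifier_aPr, hv.extra_one, hv.acc]
    rfl
  · rw [verifier_rPr, hv.rej_left, hv.rej_right]
    unfold nextRej
    ring

lemma Sound.pos {P Q : ℝ} {u : ℕ} (h : Sound P Q u) : 0 < P := by
  rcases h with ⟨hQ, ⟨rfl, -⟩ | h⟩ <;> linarith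

lemma verifier_total_pos (c : List Bool) (n : ℕ) :
    0 < verifier.aPr c (List.replicate n false) + verifier.rPr c (List.replicate n false) := by
  obtain ⟨P, Q, u, l, hs, hc⟩ := exists_certState c
  obtain ⟨ha, hr⟩ := hc.weights n
  have hs' := (hs.next l).next n
  have hext : 0 ≤ (if n = 1 then c.foldl step start 6 else 0) := by
    split_ifs
    exacts [hc.extra, le_rfl]
  rw [ha, hr]
  linarith [hs'.1, hs'.pos]

lemma verifier_complete {i : ℕ} (hi : 1 ≤ i) :
    2 / 3 ≤ verifier.accProb (honestCert i) (List.replicate (2 ^ i) false) := by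
  obtain ⟨i, rfl⟩ := Nat.exists_eq_add_of_le' hi
  obtain ⟨P, hP, hc⟩ := certState_honestCert i
  obtain ⟨ha, hr⟩ := hc.weights (2 ^ (i + 1))
  rw [MAPostPFA.accProb, le_div_iff₀ (verifier_total_pos _ _), ha, hr, if_neg (by simp),
    nextRej_self, ← pow_succ', nextRej_self]
  linarith

lemma verifier_complete_one :
    2 / 3 ≤ verifier.accProb [] (List.replicate (2 ^ 0) false) := by
  obtain ⟨ha, hr⟩ := CertState.weights (c := []) certState_start 1
  rw [MAPostPFA.accProb, le_div_iff₀ (verifier_total_pos _ _), pow_zero, ha, hr]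
  simp only [nextAcc, nextRej, start, List.foldl_nil, Matrix.cons_val, if_true]
  norm_num

lemma verifier_sound {n : ℕ} (hn : ¬ ∃ i : ℕ, n = 2 ^ i) (c : List Bool) :
    2 / 3 ≤ verifier.rejProb c (List.replicate n false) := by
  obtain ⟨P, Q, u, l, hs, hc⟩ := exists_certState c
  obtain ⟨ha, hr⟩ := hc.weights n
  have hn1 : n ≠ 1 := fun h => hn ⟨0, h⟩
  rw [MAPostPFA.rejProb, le_div_iff₀ (verifier_total_pos _ _), ha, hr, if_neg hn1]
  obtain ⟨hQ, ⟨-, j, hj⟩ | h⟩ := (hs.next l).next n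
  · cases j with
    | zero => omega
    | succ j => exact absurd ⟨j, by rw [pow_succ] at hj; omega⟩ hn
  · linarith

end UPower

/-- an MA-PostPFA with certificate alphabet `{a,b}` (encoded as `Bool`, with
`a = false`, `b = true`) and input alphabet `{a}` verifies `UPOWER` with bounded error;
for input `a^(2^i)` with `i ≥ 1` the certificate `a^(2^0) b a^(2^1) b ⋯ b a^(2^(i−1))`
suffices, and for input `a` some certificate of length at most 2 suffices. -/
theorem mapostpfa_upower :
    ∃ (ε : ℝ) (M : MAPostPFA Bool),
      ε < 1 / 2 ∧
      (∀ (c : List Bool) (n : ℕ),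
        0 < M.aPr c (List.replicate n false) + M.rPr c (List.replicate n false)) ∧
      (∀ i : ℕ, 1 ≤ i →
        1 - ε ≤ M.accProb
            (List.intercalate [true] ((List.range i).map fun j => List.replicate (2 ^ j) false))
            (List.replicate (2 ^ i) false)) ∧
      (∃ c : List Bool, c.length ≤ 2 ∧
        1 - ε ≤ M.accProb c (List.replicate (2 ^ 0) false)) ∧
      (∀ n : ℕ, (¬ ∃ i : ℕ, n = 2 ^ i) → ∀ c : List Bool,
        1 - ε ≤ M.rejProb c (List.replicate n false)) := by
  have hε : (1 : ℝ) - 1 / 3 = 2 / 3 := by norm_num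
  refine ⟨1 / 3, UPower.verifier, by norm_num, UPower.verifier_total_pos, ?_, ?_, ?_⟩ <;> rw [hε]
  · exact fun i hi => UPower.verifier_complete hi
  · exact ⟨[], by simp, UPower.verifier_complete_one⟩
  · exact fun n hn c => UPower.verifier_sound hn c
end

section
/- For every binary language L ⊆ {a,b}* there exist ε < 1/2, a finite certificate alphabet Γ, a constant C, and an MA-PostQFA M over input alphabet {a,b} and certificate alphabet Γ such that: a(c,x)+r(c,x) > 0 for all certificates and inputs; for every x ∈ L some certificate of length at most C·(|x|+2)·2^(|x|+1) gives acceptance probability at least 1−ε; and for every x ∉ L and every certificate c ∈ Γ*, the rejection probability is at least 1−ε. Hence every binary language is verified by a bounded-error MA-PostQFA using exponential-size certificates. -/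
open Matrix

/-- A superoperator on `ℂ^m`: a finite family of `m×m` complex matrices `E_1,…,E_k`
with `∑ j, E_jᴴ E_j = I`. -/
structure Superop (m : ℕ) where
  k : ℕ
  E : Fin k → Matrix (Fin m) (Fin m) ℂ
  valid : ∑ j, (E j)ᴴ * E j = 1

/-- Action of a superoperator on a density matrix: `ρ ↦ ∑ j, E_j ρ E_jᴴ`. -/
noncomputable def Superop.app {m : ℕ} (S : Superop m) (ρ : Matrix (Fin m) (Fin m) ℂ) :
    Matrix (Fin m) (Fin m) ℂ :=
  ∑ j, S.E j * ρ * (S.E j)ᴴ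

/-- The initial density matrix `e₁ e₁†`. -/
def rho0 (m : ℕ) : Matrix (Fin m) (Fin m) ℂ :=
  Matrix.of fun j j' => if j.val = 0 ∧ j'.val = 0 then 1 else 0

/-- An MA-PostQFA whose certificate and input symbols range over the type `Sym`:
superoperators for the markers `◐, ◑, ¢, $` and for each symbol, together with disjoint
sets of postselecting accepting and rejecting states. -/
structure MAPostQFA (Sym : Type) where
  m : ℕ
  Eopen : Superop m
  Eclose : Superop m
  Ecent : Superop m
  Edollar : Superop m
  Esym : Sym → Superop m
  Qacc : Finset (Fin m)
  Qrej : Finset (Fin m)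
  disj : Disjoint Qacc Qrej

namespace MAPostQFA

variable {Sym : Type}

/-- The final density matrix on certificate `c` and input `x`: apply
`E_◐, E_{c_1}, …, E_{c_k}, E_◑, E_¢, E_{x_1}, …, E_{x_l}, E_$` in order to `ρ₀`. -/
noncomputable def finalRho (M : MAPostQFA Sym) (c x : List Sym) : Matrix (Fin M.m) (Fin M.m) ℂ :=
  M.Edollar.app <|
    x.foldl (fun ρ s => (M.Esym s).app ρ) <|
      M.Ecent.app <| M.Eclose.app <|
        c.foldl (fun ρ s => (M.Esym s).app ρ) (M.Eopen.app (rho0 M.m))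

/-- `a(c,x)`: total final weight on the postselecting accepting states. -/
noncomputable def aPr (M : MAPostQFA Sym) (c x : List Sym) : ℝ :=
  ∑ j ∈ M.Qacc, (M.finalRho c x j j).re

/-- `r(c,x)`: total final weight on the postselecting rejecting states. -/
noncomputable def rPr (M : MAPostQFA Sym) (c x : List Sym) : ℝ :=
  ∑ j ∈ M.Qrej, (M.finalRho c x j j).re

/-- Acceptance probability `a/(a+r)` after postselection. -/
noncomputable def accProb (M : MAPostQFA Sym) (c x : List Sym) : ℝ :=
  M.aPr c x / (M.aPr c x + M.rPr c x)

/-- Rejection probability `r/(a+r)` after postselection. -/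
noncomputable def rejProb (M : MAPostQFA Sym) (c x : List Sym) : ℝ :=
  M.rPr c x / (M.aPr c x + M.rPr c x)

end MAPostQFA

/-- Outside the last (garbage) coordinate, `ρ` is a positive multiple of the projection onto the
real vector `v`. -/
def IsScaledPure {m : ℕ} (ρ : Matrix (Fin (m + 1)) (Fin (m + 1)) ℂ) (v : Fin m → ℝ) : Prop :=
  ∃ t : ℝ, 0 < t ∧ ∀ i j, ρ i.castSucc j.castSucc = ((t * (v i * v j) : ℝ) : ℂ)

open scoped Matrix.Norms.L2Operator MatrixOrder in
/-- Every square matrix can be scaled to a contraction, whose defect is a Gram matrix. -/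
theorem exists_smul_conjTranspose_mul_add_eq_one {m : ℕ} (P : Matrix (Fin m) (Fin m) ℂ) :
    ∃ (s : ℝ) (B : Matrix (Fin m) (Fin m) ℂ), 0 < s ∧
      ((s : ℂ) • P)ᴴ * ((s : ℂ) • P) + Bᴴ * B = 1 := by
  have hpos : 0 < ‖P‖ + 1 := by positivity
  set s : ℝ := (‖P‖ + 1)⁻¹ with hs
  set Q := (s : ℂ) • P with hQ
  have hnorm : ‖Q‖ ≤ 1 := by
    rw [hQ, norm_smul, Complex.norm_real, hs, norm_inv, Real.norm_of_nonneg hpos.le,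
      inv_mul_le_iff₀ hpos]
    linarith
  have hle : star Q * Q ≤ 1 := by
    refine (CStarAlgebra.star_mul_le_algebraMap_norm_sq (a := Q)).trans ?_
    rw [← map_one (algebraMap ℝ (Matrix (Fin m) (Fin m) ℂ))]
    exact algebraMap_mono _ (pow_le_one₀ (norm_nonneg _) hnorm)
  obtain ⟨B, hB⟩ := CStarAlgebra.nonneg_iff_eq_star_mul_self.mp (sub_nonneg.mpr hle)
  refine ⟨s, B, inv_pos.mpr hpos, ?_⟩
  rw [← star_eq_conjTranspose, ← star_eq_conjTranspose, ← hB]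
  abel

/-- The extension of a real matrix by a zero row and a zero column, over `ℂ`. -/
def padLast {m : ℕ} (A : Matrix (Fin m) (Fin m) ℝ) : Matrix (Fin (m + 1)) (Fin (m + 1)) ℂ :=
  Matrix.of fun i j =>
    Fin.lastCases (motive := fun _ => ℂ) 0
      (fun i' => Fin.lastCases (motive := fun _ => ℂ) 0 (fun j' => (A i' j' : ℂ)) j) i

theorem padLast_castSucc_castSucc {m : ℕ} (A : Matrix (Fin m) (Fin m) ℝ) (i j : Fin m) :
    padLast A i.castSucc j.castSucc = A i j := by
  simp [padLast]

theorem padLast_castSucc_last {m : ℕ} (A : Matrix (Fin m) (Fin m) ℝ) (i : Fin m) :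
    padLast A i.castSucc (Fin.last m) = 0 := by
  simp [padLast]

/-- Up to a positive factor, every real linear map on pure states is realized by a superoperator
that discards the remaining weight into the garbage coordinate. -/
theorem exists_superop_isScaledPure_mulVec {m : ℕ} (A : Matrix (Fin m) (Fin m) ℝ) :
    ∃ S : Superop (m + 1), ∀ ρ v, IsScaledPure ρ v → IsScaledPure (S.app ρ) (A *ᵥ v) := by
  obtain ⟨s, B, hs, hB⟩ := exists_smul_conjTranspose_mul_add_eq_one (padLast A)
  let F : Fin (m + 1) → Matrix (Fin (m + 1)) (Fin (m + 1)) ℂ := fun j =>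
    Matrix.of fun a b => if a = Fin.last m then B j b else 0
  have hF : ∑ j, (F j)ᴴ * F j = Bᴴ * B := by
    ext a b
    simp [F, Matrix.sum_apply, Matrix.mul_apply, Fin.sum_univ_castSucc (n := m),
      Fin.castSucc_ne_last]
  refine ⟨⟨m + 2, Fin.cons ((s : ℂ) • padLast A) F, ?_⟩, ?_⟩
  · rw [Fin.sum_univ_succ]
    simpa only [Fin.cons_zero, Fin.cons_succ, hF] using hB
  · rintro ρ v ⟨t, ht, hρ⟩
    refine ⟨s ^ 2 * t, by positivity, fun i j => ?_⟩
    have hFzero : ∀ k, (F k * ρ * (F k)ᴴ) i.castSucc j.castSucc = 0 := fun k => by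
      simp [F, Matrix.mul_apply, Fin.castSucc_ne_last]
    rw [Superop.app, Matrix.sum_apply, Fin.sum_univ_succ]
    simp only [Fin.cons_zero, Fin.cons_succ, hFzero, Finset.sum_const_zero, add_zero]
    simp only [conjTranspose_smul, Matrix.smul_mul, Matrix.smul_apply,
      Matrix.mul_apply, conjTranspose_apply, Fin.sum_univ_castSucc (n := m),
      padLast_castSucc_castSucc, padLast_castSucc_last, hρ, zero_mul, add_zero, star_zero,
      mulVec, dotProduct]
    push_cast
    simp only [smul_eq_mul, RCLike.star_def, Complex.conj_ofReal, Finset.sum_mul,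
      Finset.mul_sum, mul_zero, add_zero]
    refine Finset.sum_congr rfl fun k _ => Finset.sum_congr rfl fun l _ => ?_
    ring

/-- A superoperator realizing the given real matrix up to scaling. -/
noncomputable def realizingSuperop {m : ℕ} (A : Matrix (Fin m) (Fin m) ℝ) : Superop (m + 1) :=
  (exists_superop_isScaledPure_mulVec A).choose

theorem IsScaledPure.app_realizingSuperop {m : ℕ} {ρ : Matrix (Fin (m + 1)) (Fin (m + 1)) ℂ}
    {v w : Fin m → ℝ} (h : IsScaledPure ρ v) (A : Matrix (Fin m) (Fin m) ℝ) (hw : A *ᵥ v = w) :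
    IsScaledPure ((realizingSuperop A).app ρ) w :=
  hw ▸ (exists_superop_isScaledPure_mulVec A).choose_spec ρ v h

/-- Bijective base-two numeration of binary words. -/
def wordIndex (x : List Bool) : ℕ :=
  x.foldl (fun n b => 2 * n + 1 + b.toNat) 0

theorem wordIndex_append_singleton (x : List Bool) (b : Bool) :
    wordIndex (x ++ [b]) = 2 * wordIndex x + 1 + b.toNat := by
  simp [wordIndex]

theorem wordIndex_injective : Function.Injective wordIndex := by
  intro x
  induction x using List.reverseRecOn with
  | nil =>
    intro y h
    induction y using List.reverseRecOn with
    | nil => rfl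
    | append_singleton y b _ =>
      rw [wordIndex_append_singleton, show wordIndex [] = 0 from rfl] at h
      omega
  | append_singleton x a ih =>
    intro y h
    induction y using List.reverseRecOn with
    | nil =>
      rw [wordIndex_append_singleton, show wordIndex [] = 0 from rfl] at h
      omega
    | append_singleton y b _ =>
      rw [wordIndex_append_singleton, wordIndex_append_singleton] at h
      have ha := Bool.toNat_le a
      have hb := Bool.toNat_le b
      have hab : a = b := by
        cases a <;> cases b <;> simp only [Bool.toNat_true, Bool.toNat_false] at h <;>
          first | rfl | omega
      rw [ih (show wordIndex x = wordIndex y by omega), hab]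

theorem wordIndex_add_two_le (x : List Bool) : wordIndex x + 2 ≤ 2 ^ (x.length + 1) := by
  induction x using List.reverseRecOn with
  | nil => simp [wordIndex]
  | append_singleton x b ih =>
    have hb := Bool.toNat_le b
    rw [wordIndex_append_singleton, List.length_append, List.length_singleton, pow_succ]
    omega

/-- The number with base-five digits `χ k, χ (k + 1), …`, the first one in the units place. -/
noncomputable def digitTail (χ : ℕ → Bool) (k : ℕ) : ℝ :=
  Cardinal.cantorFunction (1 / 5) fun n => χ (k + n)

theorem digitTail_eq (χ : ℕ → Bool) (k : ℕ) :
    digitTail χ k = (χ k).toNat + digitTail χ (k + 1) / 5 := by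
  rw [digitTail, Cardinal.cantorFunction_succ _ (by norm_num) (by norm_num), digitTail]
  have h : (fun n => χ (k + (n + 1))) = fun n => χ (k + 1 + n) := by
    funext n
    congr 1
    omega
  rw [h]
  cases χ k <;> simp <;> ring

theorem digitTail_nonneg (χ : ℕ → Bool) (k : ℕ) : 0 ≤ digitTail χ k :=
  tsum_nonneg fun _ => Cardinal.cantorFunctionAux_nonneg (by norm_num)

theorem digitTail_le (χ : ℕ → Bool) (k : ℕ) : digitTail χ k ≤ 5 / 4 := by
  have h : digitTail χ k ≤ Cardinal.cantorFunction (1 / 5) fun _ => true :=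
    Cardinal.cantorFunction_le (by norm_num) (by norm_num) fun _ _ => rfl
  refine h.trans_eq ?_
  simp only [Cardinal.cantorFunction, Cardinal.cantorFunctionAux, cond_true]
  rw [tsum_geometric_of_lt_one (by norm_num) (by norm_num)]
  norm_num

/-- Strip the claimed digits `c` from the number `digitTail χ 0`, shifting after each of them. -/
noncomputable def residue (χ : ℕ → Bool) (c : List Bool) : ℝ :=
  c.foldl (fun y b => 5 * (y - (b.toNat : ℝ))) (digitTail χ 0)

theorem residue_append_singleton (χ : ℕ → Bool) (c : List Bool) (b : Bool) :
    residue χ (c ++ [b]) = 5 * (residue χ c - (b.toNat : ℝ)) := by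
  simp [residue]

theorem residue_map_range (χ : ℕ → Bool) (n : ℕ) :
    residue χ ((List.range n).map χ) = digitTail χ n := by
  induction n with
  | zero => simp [residue]
  | succ n ih =>
    rw [List.range_succ, List.map_append, List.map_singleton, residue_append_singleton, ih,
      digitTail_eq χ n]
    ring

theorem residue_eq_or_far (χ : ℕ → Bool) (c : List Bool) :
    residue χ c = digitTail χ c.length ∨ 5 ≤ residue χ c ∨ residue χ c ≤ -3 := by
  induction c using List.reverseRecOn with
  | nil => simp [residue]
  | append_singleton c b ih =>
    rw [residue_append_singleton, List.length_append, List.length_singleton]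
    have hstep := digitTail_eq χ c.length
    have hnonneg := digitTail_nonneg χ (c.length + 1)
    have hle := digitTail_le χ (c.length + 1)
    rcases ih with h | h | h
    · rw [h, hstep]
      cases b <;> cases χ c.length <;> simp only [Bool.toNat_true, Bool.toNat_false] <;>
        push_cast
      · left; ring
      · right; left; linarith
      · right; right; linarith
      · left; ring
    · right; left
      cases b <;> simp only [Bool.toNat_true, Bool.toNat_false] <;> push_cast <;> linarith
    · right; right
      cases b <;> simp only [Bool.toNat_true, Bool.toNat_false] <;> push_cast <;> linarith

/-- The superoperators of the verifier for certificate and input symbols. -/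
noncomputable def symbolSuperop : Bool ⊕ Bool → Superop 5 :=
  Sum.elim
    (fun b => realizingSuperop
      !![1, 0, 0, 0; 1, 1, 0, 0; 0, 0, 1, 0; -5 * (b.toNat : ℝ), 0, 0, 5])
    (fun b => realizingSuperop
      !![1, 0, 0, 0; 0, 1, 0, 0; 1 + (b.toNat : ℝ), 0, 2, 0; 0, 0, 0, 1])

/-- The verifier for the digit sequence `χ`. Its state vector is `(1, n, k, y)`, where `n` counts
the certificate symbols, `k` is the index of the input word, and `y` is the residue of
`digitTail χ 0` after the certificate digits and a final digit one. -/
noncomputable def digitVerifier (χ : ℕ → Bool) : MAPostQFA (Bool ⊕ Bool) where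
  m := 5
  Eopen := realizingSuperop !![1, 0, 0, 0; 0, 0, 0, 0; 0, 0, 0, 0; digitTail χ 0, 0, 0, 0]
  Eclose := realizingSuperop !![1, 0, 0, 0; 0, 1, 0, 0; 0, 0, 1, 0; -1, 0, 0, 1]
  Ecent := realizingSuperop 1
  Edollar := realizingSuperop !![1, 0, 0, 0; 0, 2, -2, 0; 0, 0, 0, 0; 0, 0, 0, 2]
  Esym := symbolSuperop
  Qacc := {0}
  Qrej := {1, 3}
  disj := by decide

theorem isScaledPure_rho0 : IsScaledPure (rho0 5) ![1, 0, 0, 0] := by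
  refine ⟨1, one_pos, fun i j => ?_⟩
  fin_cases i <;> fin_cases j <;> simp [rho0]

theorem isScaledPure_foldl_certificate (χ : ℕ → Bool) (c : List Bool)
    {ρ : Matrix (Fin 5) (Fin 5) ℂ} (hρ : IsScaledPure ρ ![1, 0, 0, digitTail χ 0]) :
    IsScaledPure
      ((c.map Sum.inl).foldl (fun ρ s => (symbolSuperop s).app ρ) ρ)
      ![1, (c.length : ℝ), 0, residue χ c] := by
  induction c using List.reverseRecOn with
  | nil => simpa [residue] using hρ
  | append_singleton c b ih =>
    rw [List.map_append, List.foldl_append]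
    refine ih.app_realizingSuperop _ ?_
    rw [residue_append_singleton]
    ext i
    fin_cases i <;> simp [mulVec, dotProduct, Fin.sum_univ_four] <;> ring

theorem isScaledPure_foldl_input (x : List Bool) {n y : ℝ}
    {ρ : Matrix (Fin 5) (Fin 5) ℂ} (hρ : IsScaledPure ρ ![1, n, 0, y]) :
    IsScaledPure
      ((x.map Sum.inr).foldl (fun ρ s => (symbolSuperop s).app ρ) ρ)
      ![1, n, (wordIndex x : ℝ), y] := by
  induction x using List.reverseRecOn with
  | nil => simpa [wordIndex] using hρ
  | append_singleton x b ih =>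
    rw [List.map_append, List.foldl_append]
    refine ih.app_realizingSuperop _ ?_
    rw [wordIndex_append_singleton]
    ext i
    fin_cases i <;> simp [mulVec, dotProduct, Fin.sum_univ_four]; ring

theorem isScaledPure_finalRho (χ : ℕ → Bool) (c x : List Bool) :
    IsScaledPure (m := 4) ((digitVerifier χ).finalRho (c.map Sum.inl) (x.map Sum.inr))
      ![1, 2 * ((c.length : ℝ) - wordIndex x), 0, 2 * (residue χ c - 1)] := by
  have hopen := isScaledPure_rho0.app_realizingSuperop
    (w := ![1, 0, 0, digitTail χ 0])
    !![1, 0, 0, 0; 0, 0, 0, 0; 0, 0, 0, 0; digitTail χ 0, 0, 0, 0]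
    (by ext i; fin_cases i <;> simp [mulVec, dotProduct, Fin.sum_univ_four])
  have hclose := (isScaledPure_foldl_certificate χ c hopen).app_realizingSuperop
    (w := ![1, (c.length : ℝ), 0, residue χ c - 1])
    !![1, 0, 0, 0; 0, 1, 0, 0; 0, 0, 1, 0; -1, 0, 0, 1]
    (by ext i; fin_cases i <;> simp [mulVec, dotProduct, Fin.sum_univ_four]; ring)
  have hcent := hclose.app_realizingSuperop 1 (Matrix.one_mulVec _)
  refine (isScaledPure_foldl_input x hcent).app_realizingSuperop _ ?_
  ext i
  fin_cases i <;> simp [mulVec, dotProduct, Fin.sum_univ_four]; ring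

theorem exists_aPr_rPr_digitVerifier (χ : ℕ → Bool) (c x : List Bool) :
    ∃ t : ℝ, 0 < t ∧
      (digitVerifier χ).aPr (c.map Sum.inl) (x.map Sum.inr) = t ∧
      (digitVerifier χ).rPr (c.map Sum.inl) (x.map Sum.inr) =
        t * (4 * ((c.length : ℝ) - wordIndex x) ^ 2 + 4 * (residue χ c - 1) ^ 2) := by
  obtain ⟨t, ht, hρ⟩ := isScaledPure_finalRho χ c x
  refine ⟨t, ht, ?_, ?_⟩
  · have h := congrArg Complex.re (hρ 0 0)
    rw [Complex.ofReal_re] at h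
    refine (Finset.sum_singleton _ _).trans (h.trans ?_)
    simp
  · have h₁ := congrArg Complex.re (hρ 1 1)
    have h₃ := congrArg Complex.re (hρ 3 3)
    rw [Complex.ofReal_re] at h₁ h₃
    refine (Finset.sum_pair (show (1 : Fin 5) ≠ 3 by decide)).trans
      ((congrArg₂ (· + ·) h₁ h₃).trans ?_)
    simp
    ring

/-- every binary language `L ⊆ {a,b}*` (with `{a,b}` encoded as `Bool`) is
verified by a bounded-error MA-PostQFA over some finite certificate alphabet `Γ`, using
certificates of size at most `C·(|x|+2)·2^(|x|+1)` for members `x`. -/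
theorem mapostqfa_binary (L : Set (List Bool)) :
    ∃ (ε : ℝ) (Γ : Type) (_ : Fintype Γ) (C : ℕ) (M : MAPostQFA (Γ ⊕ Bool)),
      ε < 1 / 2 ∧
      (∀ (c : List Γ) (x : List Bool),
        0 < M.aPr (c.map Sum.inl) (x.map Sum.inr) + M.rPr (c.map Sum.inl) (x.map Sum.inr)) ∧
      (∀ x ∈ L, ∃ c : List Γ,
        c.length ≤ C * (x.length + 2) * 2 ^ (x.length + 1) ∧
        1 - ε ≤ M.accProb (c.map Sum.inl) (x.map Sum.inr)) ∧
      (∀ x ∉ L, ∀ c : List Γ,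
        1 - ε ≤ M.rejProb (c.map Sum.inl) (x.map Sum.inr)) := by
  classical
  let χ : ℕ → Bool := fun n => decide (∃ x ∈ L, wordIndex x = n)
  refine ⟨1 / 3, Bool, inferInstance, 1, digitVerifier χ, by norm_num, ?_, ?_, ?_⟩
  · intro c x
    obtain ⟨t, ht, ha, hr⟩ := exists_aPr_rPr_digitVerifier χ c x
    rw [ha, hr]
    positivity
  · intro x hx
    refine ⟨(List.range (wordIndex x)).map χ, ?_, ?_⟩
    · rw [List.length_map, List.length_range, one_mul]
      calc wordIndex x ≤ 2 ^ (x.length + 1) := by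
            have := wordIndex_add_two_le x
            omega
        _ ≤ (x.length + 2) * 2 ^ (x.length + 1) := Nat.le_mul_of_pos_left _ (by omega)
    · obtain ⟨t, ht, ha, hr⟩ :=
        exists_aPr_rPr_digitVerifier χ ((List.range (wordIndex x)).map χ) x
      have hχ : χ (wordIndex x) = true := decide_eq_true ⟨x, hx, rfl⟩
      have hstep := digitTail_eq χ (wordIndex x)
      have hnonneg := digitTail_nonneg χ (wordIndex x)
      have hnonneg' := digitTail_nonneg χ (wordIndex x + 1)
      have hle := digitTail_le χ (wordIndex x + 1)
      rw [hχ, Bool.toNat_true, Nat.cast_one] at hstep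
      have hsq : (digitTail χ (wordIndex x) - 1) ^ 2 ≤ (1 / 4) ^ 2 :=
        pow_le_pow_left₀ (by linarith) (by linarith) 2
      rw [MAPostQFA.accProb, ha, hr, List.length_map, List.length_range, residue_map_range,
        le_div_iff₀ (by positivity)]
      nlinarith
  · intro x hx c
    obtain ⟨t, ht, ha, hr⟩ := exists_aPr_rPr_digitVerifier χ c x
    have hfar : 9 / 4 ≤
        4 * ((c.length : ℝ) - wordIndex x) ^ 2 + 4 * (residue χ c - 1) ^ 2 := by
      by_cases hlen : c.length = wordIndex x
      · have hχ : χ (wordIndex x) = false :=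
          decide_eq_false fun ⟨y, hy, hyx⟩ => hx (wordIndex_injective hyx ▸ hy)
        have hstep := digitTail_eq χ (wordIndex x)
        have hle := digitTail_le χ (wordIndex x + 1)
        rw [hχ, Bool.toNat_false, Nat.cast_zero] at hstep
        have hres := residue_eq_or_far χ c
        rw [hlen] at hres
        rcases hres with h | h | h <;>
          nlinarith [sq_nonneg ((c.length : ℝ) - wordIndex x)]
      · have hsq_int : (1 : ℤ) ≤ ((c.length : ℤ) - wordIndex x) ^ 2 :=
          Int.add_one_le_of_lt (sq_pos_of_ne_zero (sub_ne_zero.mpr (by exact_mod_cast hlen)))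
        have hsq_real : (1 : ℝ) ≤ ((c.length : ℝ) - wordIndex x) ^ 2 := by exact_mod_cast hsq_int
        nlinarith [sq_nonneg (residue χ c - 1)]
    rw [MAPostQFA.rejProb, ha, hr, le_div_iff₀ (by positivity)]
    nlinarith
end
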